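/- Fix an integer k ≥ 2 and a real θ > log₂ 3 such that for every δ' > 0 there exists N with: every T_k-free partially directed k-graph on n ≥ N vertices with α·C(n,k) undirected edges and β·C(n,k) directed edges satisfies α + θβ ≤ 1 + δ'. Then for every ρ > 0 there exist δ > 0 and n₀ such that for all n ≥ n₀: if G is a k-SAT formula on n variables which, for every k-SAT formula B that is simple, not minimal, and uses at most 2(k+1) variables, contains at most δ·n^{v(B)} copies of B, and if wt(G) ≥ 1 − δ, then G can be made unate by deleting at most ρ·n^k clauses. -/

import Mathlib

section Defs

variable {V W : Type*}

/-- A clause is a finite set of literals; a literal is a variable paired with a polarity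
(`true` = positive, `false` = negative). -/
abbrev SatClause (V : Type*) := Finset (V × Bool)

/-- A formula is a finite set of clauses. -/
abbrev SatFormula (V : Type*) := Finset (SatClause V)

/-- The set of variables used by a clause. -/
def clauseVars [DecidableEq V] (C : SatClause V) : Finset V := C.image Prod.fst

/-- A valid `k`-SAT clause: `k` literals on `k` distinct variables. -/
def IsKClause [DecidableEq V] (k : ℕ) (C : SatClause V) : Prop :=
  C.card = k ∧ (clauseVars C).card = k

/-- A valid `k`-SAT formula. -/
def IsKFormula [DecidableEq V] (k : ℕ) (G : SatFormula V) : Prop :=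
  ∀ C ∈ G, IsKClause k C

/-- An assignment satisfies a clause if it makes all of its literals true. -/
def SatisfiesClause (a : V → Bool) (C : SatClause V) : Prop := ∀ l ∈ C, a l.1 = l.2

/-- A formula is minimal if every clause has a witness assignment satisfying it and no other
clause. -/
def MinimalFormula (G : SatFormula V) : Prop :=
  ∀ C ∈ G, ∃ w : V → Bool, SatisfiesClause w C ∧ ∀ C' ∈ G, SatisfiesClause w C' → C' = C

/-- A formula is simple if no two distinct clauses use the same set of variables. -/
def SimpleFormula [DecidableEq V] (G : SatFormula V) : Prop :=
  ∀ C ∈ G, ∀ C' ∈ G, clauseVars C = clauseVars C' → C = C'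

/-- A formula is unate if every variable occurs with only one polarity. -/
def UnateFormula (G : SatFormula V) : Prop :=
  ∀ x : V, ¬ ((∃ C ∈ G, (x, true) ∈ C) ∧ (∃ C ∈ G, (x, false) ∈ C))

/-- The set of variables used by a formula. -/
def formulaVars [DecidableEq V] (G : SatFormula V) : Finset V := G.biUnion clauseVars

/-- `f` is a `k`-SAT function: it is computed by some `k`-SAT formula (value `1` iff some
clause has all its literals satisfied). -/
def IsKSatFunction (k n : ℕ) (f : (Fin n → Bool) → Bool) : Prop :=
  ∃ G : SatFormula (Fin n), IsKFormula k G ∧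
    ∀ a : Fin n → Bool, f a = true ↔ ∃ C ∈ G, SatisfiesClause a C

/-- Relabel the variables of a formula along `φ`. -/
def mapFormula [DecidableEq V] [DecidableEq W] (φ : W → V) (F : SatFormula W) : SatFormula V :=
  F.image (fun C => C.image (fun l => (φ l.1, l.2)))

/-- `G'` is a copy of `F`: it is obtained from `F` by an injective relabeling of variables. -/
def IsCopyOf [DecidableEq V] [DecidableEq W] (F : SatFormula W) (G' : SatFormula V) : Prop :=
  ∃ φ : W → V, Set.InjOn φ ↑(formulaVars F) ∧ G' = mapFormula φ F

/-- The number of copies of `F` in `G`, i.e. of subformulae of `G` isomorphic to `F`. -/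
noncomputable def copyCount [DecidableEq V] [DecidableEq W] (F : SatFormula W)
    (G : SatFormula V) : ℕ :=
  Set.ncard {G' : SatFormula V | G' ⊆ G ∧ IsCopyOf F G'}

/-- The `b`-blowup of a clause: replace each literal by the literal of the same polarity on
one of the `b` duplicates of its variable, in all possible ways. -/
def clauseBlowup [DecidableEq V] (b : ℕ) (C : SatClause V) :
    Finset (SatClause (V × Fin b)) :=
  (C.pi (fun _ => (Finset.univ : Finset (Fin b)))).image
    (fun g => C.attach.image (fun l => ((l.1.1, g l.1 l.2), l.1.2)))

/-- The `b`-blowup of a formula. -/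
def formulaBlowup [DecidableEq V] (b : ℕ) (G : SatFormula V) : SatFormula (V × Fin b) :=
  G.biUnion (clauseBlowup b)

/-- The weight of a formula on `n` variables:
`wt(G) = Σ_i log₂(i+1)·α_i(G)` where `α_i(G)·C(n,k)` counts the `k`-sets of variables
supporting exactly `i` clauses. -/
noncomputable def formulaWt (k n : ℕ) (G : SatFormula (Fin n)) : ℝ :=
  (∑ S ∈ (Finset.univ : Finset (Fin n)).powersetCard k,
    Real.logb 2 (((G.filter (fun C => clauseVars C = S)).card : ℝ) + 1)) / (n.choose k)

/-- A partially directed graph: a set of undirected edges together with a set of directed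
(pointed) edges. -/
structure PDG (V : Type*) where
  undir : Finset (Finset V)
  dir : Finset (Finset V × V)

/-- `H` is a valid `k`-PDG: all edges have `k` vertices, each directed edge is pointed at one
of its vertices, and each `k`-set carries at most one edge (undirected or directed). -/
def PDG.IsValid (k : ℕ) (H : PDG V) : Prop :=
  (∀ e ∈ H.undir, e.card = k) ∧
  (∀ p ∈ H.dir, p.1.card = k ∧ p.2 ∈ p.1) ∧
  (∀ p ∈ H.dir, p.1 ∉ H.undir) ∧
  (∀ p ∈ H.dir, ∀ q ∈ H.dir, p.1 = q.1 → p = q)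

/-- `F` is a subgraph of `H`: a copy of `F` can be obtained from `H` by deleting vertices,
deleting edges, and/or forgetting directions of edges. -/
def PDG.IsSubgraph [DecidableEq V] (F : PDG W) (H : PDG V) : Prop :=
  ∃ φ : W → V, Function.Injective φ ∧
    (∀ e ∈ F.undir, e.image φ ∈ H.undir ∨ ∃ v, (e.image φ, v) ∈ H.dir) ∧
    (∀ p ∈ F.dir, (p.1.image φ, φ p.2) ∈ H.dir)

/-- The image of a PDG under a relabeling of vertices. -/
def PDG.map [DecidableEq V] (φ : W → V) (F : PDG W) : PDG V :=
  ⟨F.undir.image (Finset.image φ), F.dir.image (fun p => (p.1.image φ, φ p.2))⟩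

/-- The PDG `T_k` on vertex set `{0, …, k}` (0-indexed): undirected edges everything-but-`k`
and everything-but-`k-2`, and the edge everything-but-`k-1` directed toward `k`. -/
def TkPDG (k : ℕ) : PDG (Fin (k + 1)) where
  undir := { Finset.univ.erase ⟨k, Nat.lt_succ_self k⟩,
             Finset.univ.erase ⟨k - 2, by omega⟩ }
  dir := { (Finset.univ.erase ⟨k - 1, by omega⟩, ⟨k, Nat.lt_succ_self k⟩) }

/-- A semisimple formula: every `k`-set of variables supports at most one clause, or exactly
two clauses whose polarities differ on exactly one variable. -/
def SemisimpleFormula [DecidableEq V] (G : SatFormula V) : Prop :=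
  ∀ C₁ ∈ G, ∀ C₂ ∈ G, C₁ ≠ C₂ → clauseVars C₁ = clauseVars C₂ →
    (((C₁ \ C₂).image Prod.fst).card = 1 ∧
      ∀ C₃ ∈ G, clauseVars C₃ = clauseVars C₁ → C₃ = C₁ ∨ C₃ = C₂)

/-- The type of a (semisimple) formula: an undirected edge on each variable set supporting
exactly one clause, and for each variable set supporting two clauses a directed edge pointed
at the variable where the two clauses differ. -/
def formulaType [DecidableEq V] (G : SatFormula V) : PDG V where
  undir := (G.filter (fun C => ∀ C' ∈ G, clauseVars C' = clauseVars C → C' = C)).image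
    clauseVars
  dir := ((G ×ˢ G).filter (fun p => p.1 ≠ p.2 ∧ clauseVars p.1 = clauseVars p.2)).biUnion
    (fun p => ((p.1 \ p.2).image Prod.fst).image (fun v => (clauseVars p.1, v)))

end Defs

namespace NearlyUnate

open Finset

section Clauses

variable {V W U : Type*} [DecidableEq V] [DecidableEq U]

/-- The clause on the variables `φ i`, `i ∈ T`, where `φ i` gets polarity `p i`. -/
def clauseAlong (φ : W → V) (T : Finset W) (p : W → Bool) : SatClause V :=
  T.image (fun i => (φ i, p i))

lemma clauseVars_clauseAlong (φ : W → V) (T : Finset W) (p : W → Bool) :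
    clauseVars (clauseAlong φ T p) = T.image φ := by
  simp [clauseVars, clauseAlong, image_image, Function.comp_def]

lemma isKClause_clauseAlong {k : ℕ} {φ : W → V} {T : Finset W} (p : W → Bool)
    (hφ : Set.InjOn φ T) (hT : T.card = k) : IsKClause k (clauseAlong φ T p) := by
  constructor
  · rw [clauseAlong, card_image_of_injOn, hT]
    intro a ha b hb hab
    exact hφ ha hb (Prod.ext_iff.1 hab).1
  · rw [clauseVars_clauseAlong, card_image_of_injOn hφ, hT]

lemma satisfies_clauseAlong {φ : W → V} {T : Finset W} {p : W → Bool} {w : V → Bool} :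
    SatisfiesClause w (clauseAlong φ T p) ↔ ∀ i ∈ T, w (φ i) = p i := by
  simp [SatisfiesClause, clauseAlong]

lemma image_clauseAlong (ψ : V → U) (φ : W → V) (T : Finset W) (p : W → Bool) :
    (clauseAlong φ T p).image (fun l => (ψ l.1, l.2)) = clauseAlong (ψ ∘ φ) T p := by
  simp [clauseAlong, image_image, Function.comp_def]

lemma polarity_unique {k : ℕ} {C : SatClause V} (hC : IsKClause k C) {x : V}
    {s t : Bool} (hs : (x, s) ∈ C) (ht : (x, t) ∈ C) : s = t := by
  have hinj : Set.InjOn Prod.fst (C : Set (V × Bool)) :=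
    card_image_iff.1 (hC.2.trans hC.1.symm)
  exact (Prod.ext_iff.1 (hinj hs ht rfl)).2

lemma mem_clauseVars {C : SatClause V} {x : V} :
    x ∈ clauseVars C ↔ ∃ s, (x, s) ∈ C := by
  simp only [clauseVars, mem_image, Prod.exists]
  constructor
  · rintro ⟨a, b, h, rfl⟩
    exact ⟨b, h⟩
  · rintro ⟨s, h⟩
    exact ⟨x, s, h, rfl⟩

lemma exists_eq_clauseAlong {k : ℕ} {C : SatClause V} (hC : IsKClause k C)
    {φ : W → V} {T : Finset W} (hT : clauseVars C = T.image φ) :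
    ∃ p : W → Bool, C = clauseAlong φ T p := by
  refine ⟨fun i => decide ((φ i, true) ∈ C), ?_⟩
  have key : ∀ x s, (x, s) ∈ C → s = decide ((x, true) ∈ C) := by
    intro x s hs
    cases s
    · symm
      rw [decide_eq_false_iff_not]
      intro ht
      exact absurd (polarity_unique hC hs ht) (by simp)
    · simpa using hs
  ext ⟨x, s⟩
  simp only [clauseAlong, mem_image, Prod.mk.injEq]
  constructor
  · intro h
    have hx : x ∈ T.image φ := hT ▸ mem_clauseVars.2 ⟨s, h⟩
    obtain ⟨i, hi, rfl⟩ := mem_image.1 hx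
    exact ⟨i, hi, rfl, (key _ _ h).symm⟩
  · rintro ⟨i, hi, rfl, rfl⟩
    have hx : φ i ∈ clauseVars C := hT ▸ mem_image_of_mem φ hi
    obtain ⟨s, hs⟩ := mem_clauseVars.1 hx
    rwa [← key _ _ hs]

lemma mem_clauseAlong_of_injOn {φ : W → V} {T : Finset W} {p : W → Bool} {i : W} {s : Bool}
    (hφ : Set.InjOn φ T) (hi : i ∈ T) : (φ i, s) ∈ clauseAlong φ T p ↔ s = p i := by
  simp only [clauseAlong, mem_image, Prod.mk.injEq]
  constructor
  · rintro ⟨j, hj, hji, rfl⟩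
    rw [hφ hj hi hji]
  · rintro rfl
    exact ⟨i, hi, rfl, rfl⟩

end Clauses

section Patterns

/-- The two duplicates of each of `k + 1` variables. -/
noncomputable def dup (k : ℕ) : Fin (k + 1) × Bool ≃ Fin (2 * (k + 1)) :=
  Fintype.equivFinOfCardEq (by simp [mul_comm])

/-- The clause obtained by choosing the duplicate `σ i` of each variable `i ∈ T`. -/
noncomputable def dupClause {k : ℕ} (σ : Fin (k + 1) → Bool) (T : Finset (Fin (k + 1)))
    (p : Fin (k + 1) → Bool) : SatClause (Fin (2 * (k + 1))) :=
  clauseAlong (fun i => dup k (i, σ i)) T p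

lemma dup_injective {k : ℕ} (σ : Fin (k + 1) → Bool) :
    Function.Injective (fun i => dup k (i, σ i)) := by
  intro i j h
  exact (Prod.ext_iff.1 ((dup k).injective h)).1

lemma clauseVars_dupClause_eq {k : ℕ} {σ τ : Fin (k + 1) → Bool}
    {T T' : Finset (Fin (k + 1))} {p q : Fin (k + 1) → Bool}
    (h : clauseVars (dupClause σ T p) = clauseVars (dupClause τ T' q)) :
    T = T' ∧ ∀ i ∈ T, σ i = τ i := by
  simp only [dupClause, clauseVars_clauseAlong] at h
  have h1 : ∀ i, i ∈ T → i ∈ T' ∧ σ i = τ i := by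
    intro i hi
    have : dup k (i, σ i) ∈ T'.image (fun i => dup k (i, τ i)) :=
      h ▸ mem_image_of_mem (fun i => dup k (i, σ i)) hi
    obtain ⟨j, hj, hji⟩ := mem_image.1 this
    have := (dup k).injective hji
    simp only [Prod.mk.injEq] at this
    obtain ⟨rfl, h2⟩ := this
    exact ⟨hj, h2.symm⟩
  have h2 : ∀ i, i ∈ T' → i ∈ T := by
    intro i hi
    have : dup k (i, τ i) ∈ T.image (fun i => dup k (i, σ i)) :=
      h ▸ mem_image_of_mem (fun i => dup k (i, τ i)) hi
    obtain ⟨j, hj, hji⟩ := mem_image.1 this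
    have := (dup k).injective hji
    simp only [Prod.mk.injEq] at this
    exact this.1 ▸ hj
  exact ⟨Subset.antisymm (fun i hi => (h1 i hi).1) h2, fun i hi => (h1 i hi).2⟩

/-- A set of clauses on `k + 1` variables, each given by its variables and polarities. -/
abbrev Pattern (k : ℕ) := Finset (Finset (Fin (k + 1)) × (Fin (k + 1) → Bool))

/-- The double blowup of the pattern contains a simple non-minimal formula. -/
def Pattern.IsBad {k : ℕ} (F : Pattern k) : Prop :=
  ∃ B : SatFormula (Fin (2 * (k + 1))), IsKFormula k B ∧ SimpleFormula B ∧
    ¬ MinimalFormula B ∧ ∀ C ∈ B, ∃ c ∈ F, ∃ σ, C = dupClause σ c.1 c.2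

/-- The clause on `T` along the first duplicates, together with all clauses obtained from it by
switching one variable to its second duplicate. -/
noncomputable def gadget {k : ℕ} (T : Finset (Fin (k + 1))) (p : Fin (k + 1) → Bool) :
    SatFormula (Fin (2 * (k + 1))) :=
  insert (dupClause (fun _ => false) T p)
    (T.image fun i => dupClause (Function.update (fun _ => false) i true) T p)

lemma mem_gadget {k : ℕ} {T : Finset (Fin (k + 1))} {p : Fin (k + 1) → Bool}
    {C : SatClause (Fin (2 * (k + 1)))} (hC : C ∈ gadget T p) :
    ∃ σ : Fin (k + 1) → Bool, C = dupClause σ T p ∧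
      ∀ i j, σ i = true → σ j = true → i = j := by
  simp only [gadget, mem_insert, mem_image] at hC
  rcases hC with rfl | ⟨i, -, rfl⟩
  · exact ⟨_, rfl, by simp⟩
  · refine ⟨_, rfl, ?_⟩
    intro a b ha hb
    simp only [Function.update_apply] at ha hb
    split_ifs at ha hb
    simp_all

lemma dupClause_congr {k : ℕ} {σ τ p q : Fin (k + 1) → Bool} {T : Finset (Fin (k + 1))}
    (h : ∀ i ∈ T, σ i = τ i) (hp : ∀ i ∈ T, p i = q i) :
    dupClause σ T p = dupClause τ T q := by
  unfold dupClause clauseAlong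
  refine image_congr fun i hi => ?_
  simp [h i hi, hp i hi]

lemma isKClause_dupClause {k : ℕ} {T : Finset (Fin (k + 1))} (hT : T.card = k)
    (σ p : Fin (k + 1) → Bool) : IsKClause k (dupClause σ T p) :=
  isKClause_clauseAlong _ (dup_injective σ).injOn hT

/-- An assignment satisfying only the first clause of the gadget assigns complementary values to
the two duplicates of each variable. -/
lemma witness_gadget {k : ℕ} {T : Finset (Fin (k + 1))} {p : Fin (k + 1) → Bool}
    {w : Fin (2 * (k + 1)) → Bool}
    (hsat : SatisfiesClause w (dupClause (fun _ => false) T p))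
    (honly : ∀ C ∈ gadget T p, SatisfiesClause w C → C = dupClause (fun _ => false) T p)
    {i : Fin (k + 1)} (hi : i ∈ T) (s : Bool) : w (dup k (i, xor (p i) s)) = s := by
  have h0 : ∀ j ∈ T, w (dup k (j, false)) = p j := satisfies_clauseAlong.1 hsat
  have h1 : w (dup k (i, true)) ≠ p i := by
    intro h
    have := honly (dupClause (Function.update (fun _ => false) i true) T p)
      (mem_insert_of_mem (mem_image_of_mem _ hi)) (satisfies_clauseAlong.2 fun j hj => by
        by_cases hji : j = i
        · subst hji; simpa using h
        · simpa [Function.update_of_ne hji] using h0 j hj)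
    have := (clauseVars_dupClause_eq (congrArg clauseVars this)).2 i hi
    simp at this
  have h0i := h0 i hi
  cases hp : p i <;> cases s <;> simp_all

/-- Two clauses on the same variables that differ in two variables form a bad pattern. -/
lemma isBad_pair {k : ℕ} {T : Finset (Fin (k + 1))} (hT : T.card = k)
    {p q : Fin (k + 1) → Bool} {a b : Fin (k + 1)} (ha : a ∈ T) (hb : b ∈ T) (hab : a ≠ b)
    (hpa : p a ≠ q a) (hpb : p b ≠ q b) : Pattern.IsBad {(T, p), (T, q)} := by
  set σ : Fin (k + 1) → Bool := fun i => xor (p i) (q i) with hσ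
  have hσa : σ a = true := by simpa [hσ] using hpa
  have hσb : σ b = true := by simpa [hσ] using hpb
  refine ⟨insert (dupClause σ T q) (gadget T p), ?_, ?_, ?_, ?_⟩
  · intro C hC
    rcases mem_insert.1 hC with rfl | hC
    · exact isKClause_dupClause hT _ _
    · obtain ⟨τ, rfl, -⟩ := mem_gadget hC
      exact isKClause_dupClause hT _ _
  · have hne : ∀ C ∈ gadget T p, clauseVars (dupClause σ T q) ≠ clauseVars C := by
      intro C hC h
      obtain ⟨τ, rfl, hτ⟩ := mem_gadget hC
      have h2 := (clauseVars_dupClause_eq h).2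
      exact hab (hτ a b ((h2 a ha).symm.trans hσa) ((h2 b hb).symm.trans hσb))
    intro C hC C' hC' h
    rcases mem_insert.1 hC with rfl | hC
    · rcases mem_insert.1 hC' with rfl | hC'
      · rfl
      · exact absurd h (hne _ hC')
    · rcases mem_insert.1 hC' with rfl | hC'
      · exact absurd h.symm (hne _ hC)
      · obtain ⟨τ, rfl, -⟩ := mem_gadget hC
        obtain ⟨τ', rfl, -⟩ := mem_gadget hC'
        exact dupClause_congr (clauseVars_dupClause_eq h).2 fun _ _ => rfl
  · intro hmin
    obtain ⟨w, hw, honly⟩ := hmin (dupClause (fun _ => false) T p)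
      (mem_insert_of_mem (mem_insert_self _ _))
    have hgad := fun C hC => honly C (mem_insert_of_mem hC)
    have := honly _ (mem_insert_self _ _) (satisfies_clauseAlong.2 fun i hi =>
      witness_gadget hw hgad hi (q i))
    have := (clauseVars_dupClause_eq (congrArg clauseVars this)).2 a ha
    simp [hσa] at this
  · intro C hC
    rcases mem_insert.1 hC with rfl | hC
    · exact ⟨(T, q), by simp, σ, rfl⟩
    · obtain ⟨τ, rfl, -⟩ := mem_gadget hC
      exact ⟨(T, p), by simp, τ, rfl⟩

/-- Three clauses on `k + 1` variables such that two of them disagree at the variable missing from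
the third form a bad pattern. -/
lemma isBad_triple {k : ℕ} {v a b : Fin (k + 1)} (hva : v ≠ a) (hvb : v ≠ b) (hab : a ≠ b)
    {p q r : Fin (k + 1) → Bool} (hqr : q v ≠ r v) :
    Pattern.IsBad {(univ.erase v, p), (univ.erase a, q), (univ.erase b, r)} := by
  have hcard : ∀ i : Fin (k + 1), (univ.erase i).card = k := by simp
  have herase : ∀ {i j : Fin (k + 1)}, univ.erase i = univ.erase j → i = j := by
    intro i j h
    by_contra hij
    have : i ∈ univ.erase j := by simp [hij]
    rw [← h] at this
    simp at this
  set σ : (Fin (k + 1) → Bool) → Fin (k + 1) → Bool :=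
    fun s i => if i = v then false else xor (p i) (s i) with hσ
  refine ⟨insert (dupClause (σ q) (univ.erase a) q) (insert (dupClause (σ r) (univ.erase b) r)
    (gadget (univ.erase v) p)), ?_, ?_, ?_, ?_⟩
  · intro C hC
    rcases mem_insert.1 hC with rfl | hC
    · exact isKClause_dupClause (hcard _) _ _
    rcases mem_insert.1 hC with rfl | hC
    · exact isKClause_dupClause (hcard _) _ _
    · obtain ⟨τ, rfl, -⟩ := mem_gadget hC
      exact isKClause_dupClause (hcard _) _ _
  · intro C hC C' hC' h
    rw [mem_insert, mem_insert] at hC hC'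
    rcases hC with rfl | rfl | hC <;> rcases hC' with rfl | rfl | hC'
    · rfl
    · exact absurd (herase (clauseVars_dupClause_eq h).1) hab
    · obtain ⟨τ, rfl, -⟩ := mem_gadget hC'
      exact absurd (herase (clauseVars_dupClause_eq h).1) hva.symm
    · exact absurd (herase (clauseVars_dupClause_eq h).1) hab.symm
    · rfl
    · obtain ⟨τ, rfl, -⟩ := mem_gadget hC'
      exact absurd (herase (clauseVars_dupClause_eq h).1) hvb.symm
    · obtain ⟨τ, rfl, -⟩ := mem_gadget hC
      exact absurd (herase (clauseVars_dupClause_eq h).1) hva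
    · obtain ⟨τ, rfl, -⟩ := mem_gadget hC
      exact absurd (herase (clauseVars_dupClause_eq h).1) hvb
    · obtain ⟨τ, rfl, -⟩ := mem_gadget hC
      obtain ⟨τ', rfl, -⟩ := mem_gadget hC'
      exact dupClause_congr (clauseVars_dupClause_eq h).2 fun _ _ => rfl
  · intro hmin
    obtain ⟨w, hw, honly⟩ := hmin (dupClause (fun _ => false) (univ.erase v) p)
      (mem_insert_of_mem (mem_insert_of_mem (mem_insert_self _ _)))
    have hgad := fun C hC => honly C (mem_insert_of_mem (mem_insert_of_mem hC))
    have hsat : ∀ s : Fin (k + 1) → Bool, w (dup k (v, false)) = s v → ∀ T,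
        SatisfiesClause w (dupClause (σ s) T s) := by
      intro s hs T
      refine satisfies_clauseAlong.2 fun i _ => ?_
      by_cases hiv : i = v
      · subst hiv; simpa [hσ] using hs
      · simpa [hσ, hiv] using witness_gadget hw hgad (i := i) (by simp [hiv]) (s i)
    by_cases hq : w (dup k (v, false)) = q v
    · have := honly _ (mem_insert_self _ _) (hsat q hq _)
      exact hva (herase (clauseVars_dupClause_eq (congrArg clauseVars this)).1).symm
    · have hr : w (dup k (v, false)) = r v := by
        revert hq hqr
        cases w (dup k (v, false)) <;> cases q v <;> cases r v <;> simp
      have := honly _ (mem_insert_of_mem (mem_insert_self _ _)) (hsat r hr _)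
      exact hvb (herase (clauseVars_dupClause_eq (congrArg clauseVars this)).1).symm
  · intro C hC
    rcases mem_insert.1 hC with rfl | hC
    · exact ⟨(univ.erase a, q), by simp, _, rfl⟩
    rcases mem_insert.1 hC with rfl | hC
    · exact ⟨(univ.erase b, r), by simp, _, rfl⟩
    · obtain ⟨τ, rfl, -⟩ := mem_gadget hC
      exact ⟨(univ.erase v, p), by simp, τ, rfl⟩

end Patterns

section Counting

variable {α : Type*} [Fintype α] [DecidableEq α] {r : ℕ}

/-- The doubled tuples all of whose selections lie in `X`. -/
def doubled (X : Finset (Fin r → α)) : Finset (Fin r → Bool → α) :=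
  univ.filter fun z => ∀ σ : Fin r → Bool, (fun i => z i (σ i)) ∈ X

/-- The tuples which can be extended to elements of `X` by both values of `β`. -/
def slice (X : Finset (Fin (r + 1) → α)) (β : Bool → α) : Finset (Fin r → α) :=
  univ.filter fun x => ∀ s, (Fin.cons (β s) x : Fin (r + 1) → α) ∈ X

/-- The elements that extend the tuple `x` to an element of `X`. -/
def extensions (X : Finset (Fin (r + 1) → α)) (x : Fin r → α) : Finset α :=
  univ.filter fun a => (Fin.cons a x : Fin (r + 1) → α) ∈ X

lemma card_eq_sum_extensions (X : Finset (Fin (r + 1) → α)) :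
    X.card = ∑ x, (extensions X x).card := by
  rw [← card_sigma]
  refine card_bij' (fun z _ => ⟨Fin.tail z, z 0⟩) (fun p _ => Fin.cons p.2 p.1) ?_ ?_ ?_ ?_
  · intro z hz
    simpa [extensions, Fin.cons_self_tail] using hz
  · rintro ⟨x, a⟩ hp
    simpa [extensions] using hp
  · intro z _
    simp
  · rintro ⟨x, a⟩ _
    simp

lemma sum_card_slice (X : Finset (Fin (r + 1) → α)) :
    ∑ β, (slice X β).card = ∑ x, (extensions X x).card ^ 2 := by
  simp_rw [slice, card_filter]
  rw [sum_comm]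
  simp_rw [← card_filter]
  refine sum_congr rfl fun x _ => ?_
  have : (univ : Finset (Bool → α)).filter
      (fun β => ∀ s, (Fin.cons (β s) x : Fin (r + 1) → α) ∈ X)
      = Fintype.piFinset fun _ => extensions X x := by
    ext β
    simp only [extensions, Fintype.mem_piFinset, mem_filter, mem_univ, true_and]
  rw [this, Fintype.card_piFinset, prod_const, card_univ, Fintype.card_bool]

lemma sum_card_doubled_slice_le (X : Finset (Fin (r + 1) → α)) :
    ∑ β, (doubled (slice X β)).card ≤ (doubled X).card := by
  rw [← card_sigma]
  refine card_le_card_of_injOn (fun p => (Fin.cons p.1 p.2 : Fin (r + 1) → Bool → α)) ?_ ?_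
  · rintro ⟨β, z⟩ hp
    have hz : z ∈ doubled (slice X β) := (mem_sigma.1 hp).2
    refine mem_filter.2 ⟨mem_univ _, fun σ => ?_⟩
    have := (mem_filter.1 ((mem_filter.1 hz).2 (Fin.tail σ))).2 (σ 0)
    convert this using 1
    funext i
    refine Fin.cases ?_ (fun i => ?_) i
    · rfl
    · rfl
  · rintro ⟨β, z⟩ - ⟨β', z'⟩ - h
    obtain ⟨rfl, rfl⟩ := Fin.cons_injective2 h
    rfl

/-- The Cauchy–Schwarz lower bound on the number of doubled tuples. -/
lemma density_pow_le_doubled [Nonempty α] (r : ℕ) (X : Finset (Fin r → α)) :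
    ((X.card : ℝ) / (Fintype.card α : ℝ) ^ r) ^ (2 ^ r) ≤
      ((doubled X).card : ℝ) / (Fintype.card α : ℝ) ^ (2 * r) := by
  induction r with
  | zero =>
    have : X.card ≤ (doubled X).card := by
      refine card_le_card_of_injOn (fun _ => finZeroElim) ?_ ?_
      · intro x hx
        refine mem_filter.2 ⟨mem_univ _, fun σ => ?_⟩
        convert mem_coe.1 hx using 1
      · intro _ _ _ _ _
        exact Subsingleton.elim _ _
    simpa using this
  | succ r ih =>
    set n : ℝ := (Fintype.card α : ℝ) with hn
    have hn0 : 0 < n := by rw [hn]; exact_mod_cast Fintype.card_pos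
    have hcs : (X.card : ℝ) ^ 2 ≤ n ^ r * ∑ β, ((slice X β).card : ℝ) := by
      have h1 : ∑ β, ((slice X β).card : ℝ) = ∑ x, ((extensions X x).card : ℝ) ^ 2 := by
        exact_mod_cast sum_card_slice X
      rw [card_eq_sum_extensions, h1]
      have := sq_sum_le_card_mul_sum_sq (s := (univ : Finset (Fin r → α)))
        (f := fun x => ((extensions X x).card : ℝ))
      simpa [hn] using this
    have hpow : (((X.card : ℝ) / n ^ (r + 1)) ^ 2) ^ (2 ^ r) ≤
        (∑ β : Bool → α, (1 / n ^ 2) * ((slice X β).card / n ^ r)) ^ (2 ^ r) := by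
      refine pow_le_pow_left₀ (by positivity) ?_ _
      rw [← mul_sum, ← sum_div, div_pow, div_le_iff₀ (by positivity)]
      refine hcs.trans_eq ?_
      generalize ∑ β, ((slice X β).card : ℝ) = S
      field_simp
      ring
    have hjen := Real.pow_arith_mean_le_arith_mean_pow (univ : Finset (Bool → α))
      (fun _ => 1 / n ^ 2) (fun β => (slice X β).card / n ^ r) (fun _ _ => by positivity)
      (by simp [hn]) (fun _ _ => by positivity) (2 ^ r)
    calc ((X.card : ℝ) / n ^ (r + 1)) ^ (2 ^ (r + 1))
        = (((X.card : ℝ) / n ^ (r + 1)) ^ 2) ^ (2 ^ r) := by rw [← pow_mul, pow_succ' 2 r]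
      _ ≤ ∑ β : Bool → α, 1 / n ^ 2 * ((slice X β).card / n ^ r) ^ (2 ^ r) := hpow.trans hjen
      _ ≤ ∑ β : Bool → α, 1 / n ^ 2 * (((doubled (slice X β)).card : ℝ) / n ^ (2 * r)) :=
          sum_le_sum fun β _ => mul_le_mul_of_nonneg_left (ih (slice X β)) (by positivity)
      _ = (∑ β : Bool → α, ((doubled (slice X β)).card : ℝ)) / n ^ (2 * (r + 1)) := by
          rw [← mul_sum, ← sum_div]
          generalize ∑ β, ((doubled (slice X β)).card : ℝ) = S
          field_simp
          ring
      _ ≤ _ := by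
          gcongr
          exact_mod_cast sum_card_doubled_slice_le X

lemma card_filter_comp_mem_le {ι τ : Type*} [Fintype ι] [Fintype τ]
    [DecidableEq ι] [DecidableEq τ] {g : τ → ι} (hg : Function.Injective g)
    (X : Finset (τ → α)) :
    (univ.filter fun z : ι → α => z ∘ g ∈ X).card ≤
      X.card * Fintype.card α ^ (Fintype.card ι - Fintype.card τ) := by
  have hc : Fintype.card {i // i ∉ Set.range g} = Fintype.card ι - Fintype.card τ := by
    classical
    rw [Fintype.card_subtype_compl, ← Set.card_range_of_injective hg]
  classical
  rw [← hc, ← Fintype.card_fun, ← card_univ, ← card_product]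
  refine card_le_card_of_injOn (fun z => (z ∘ g, fun i => z i.1)) ?_ ?_
  · intro z hz
    simpa using hz
  · intro z _ z' _ h
    simp only [Prod.mk.injEq] at h
    funext i
    by_cases hi : i ∈ Set.range g
    · obtain ⟨j, rfl⟩ := hi
      exact congrFun h.1 j
    · exact congrFun h.2 ⟨i, hi⟩

lemma card_filter_not_injective_le {ι : Type*} [Fintype ι] [DecidableEq ι] :
    (univ.filter fun z : ι → α => ¬ Function.Injective z).card ≤
      Fintype.card ι ^ 2 * Fintype.card α ^ (Fintype.card ι - 1) := by
  have hsub : (univ.filter fun z : ι → α => ¬ Function.Injective z) ⊆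
      (univ : Finset (ι × ι)).biUnion fun p =>
        univ.filter fun z : ι → α => p.1 ≠ p.2 ∧ z p.1 = z p.2 := by
    intro z hz
    simp only [mem_filter, mem_univ, true_and, Function.Injective, not_forall] at hz
    obtain ⟨i, j, h, hij⟩ := hz
    simp only [mem_biUnion, mem_filter, mem_univ, true_and]
    exact ⟨(i, j), hij, h⟩
  refine (card_le_card hsub).trans (card_biUnion_le.trans ?_)
  refine (sum_le_card_nsmul _ _ (Fintype.card α ^ (Fintype.card ι - 1)) ?_).trans ?_
  · rintro ⟨i, j⟩ -
    have hc : Fintype.card {x // x ≠ i} = Fintype.card ι - 1 := by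
      simp [Fintype.card_subtype_compl]
    rw [← hc, ← Fintype.card_fun, ← card_univ]
    refine card_le_card_of_injOn (fun z x => z x.1) (fun _ _ => mem_coe.2 (mem_univ _)) ?_
    intro z hz z' hz' h
    simp only [coe_filter, mem_univ, true_and, Set.mem_ofPred_eq] at hz hz'
    funext x
    by_cases hx : x = i
    · subst hx
      rw [hz.2, hz'.2]
      exact congrFun h ⟨j, hz.1.symm⟩
    · exact congrFun h ⟨x, hx⟩
  · simp [sq]

end Counting

section Supersaturation

/-- Every simple non-minimal formula on at most `2 (k + 1)` variables has few copies in `G`. -/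
def FewNonMinimal (k n : ℕ) (G : SatFormula (Fin n)) (δ : ℝ) : Prop :=
  ∀ B : SatFormula (Fin (2 * (k + 1))), IsKFormula k B → SimpleFormula B →
    ¬ MinimalFormula B → (copyCount B G : ℝ) ≤ δ * n ^ (formulaVars B).card

lemma formulaVars_mapFormula {N n : ℕ} (z : Fin N → Fin n) (B : SatFormula (Fin N)) :
    formulaVars (mapFormula z B) = (formulaVars B).image z := by
  ext x
  simp only [formulaVars, mapFormula, mem_biUnion, mem_image, mem_clauseVars]
  constructor
  · rintro ⟨_, ⟨C, hC, rfl⟩, s, hs⟩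
    obtain ⟨⟨i, t⟩, hi, h⟩ := mem_image.1 hs
    exact ⟨i, ⟨C, hC, t, hi⟩, (Prod.ext_iff.1 h).1⟩
  · rintro ⟨i, ⟨C, hC, t, hi⟩, rfl⟩
    exact ⟨_, ⟨C, hC, rfl⟩, t, mem_image.2 ⟨(i, t), hi, rfl⟩⟩

lemma card_maps_le_copyCount_mul {N n : ℕ} (B : SatFormula (Fin N)) (G : SatFormula (Fin n)) :
    (univ.filter fun z : Fin N → Fin n => Function.Injective z ∧ mapFormula z B ⊆ G).card ≤
      (N ^ N * n ^ (N - (formulaVars B).card)) * copyCount B G := by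
  set s := univ.filter fun z : Fin N → Fin n => Function.Injective z ∧ mapFormula z B ⊆ G
    with hs
  set v := (formulaVars B).card with hv
  have hvN : v ≤ N := by simpa using card_le_univ (formulaVars B)
  refine (card_le_mul_card_image (f := fun z => mapFormula z B) s
    (N ^ N * n ^ (N - v)) ?_).trans (Nat.mul_le_mul_left _ ?_)
  · intro G' hG'
    obtain ⟨z₀, hz₀, rfl⟩ := mem_image.1 hG'
    have hinj : Function.Injective z₀ := (mem_filter.1 hz₀).2.1
    have hsub : (s.filter fun z => mapFormula z B = mapFormula z₀ B) ⊆
        Fintype.piFinset fun i => if i ∈ formulaVars B then (formulaVars B).image z₀ else univ := by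
      intro z hz
      have h := congrArg formulaVars (mem_filter.1 hz).2
      rw [formulaVars_mapFormula, formulaVars_mapFormula] at h
      refine Fintype.mem_piFinset.2 fun i => ?_
      split_ifs with hi
      · exact h ▸ mem_image_of_mem z hi
      · exact mem_univ _
    refine (card_le_card hsub).trans ?_
    rw [Fintype.card_piFinset]
    have : ∀ i, (if i ∈ formulaVars B then (formulaVars B).image z₀ else univ).card =
        if i ∈ formulaVars B then v else n := by
      intro i
      split_ifs
      · exact card_image_of_injective _ hinj
      · simp
    simp only [this]
    rw [prod_ite, prod_const, prod_const]
    have h1 : (univ.filter fun i => i ∈ formulaVars B).card = v := by simp [hv]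
    have h2 : (univ.filter fun i => i ∉ formulaVars B).card = N - v := by
      rw [filter_not, card_sdiff_of_subset (filter_subset _ _), h1]
      simp
    rw [h1, h2]
    refine Nat.mul_le_mul_right _ ?_
    rcases Nat.eq_zero_or_pos v with h0 | h0
    · rw [h0]
      rcases Nat.eq_zero_or_pos N with hN | hN
      · simp [hN]
      · simpa using Nat.one_le_pow _ _ hN
    · exact (Nat.pow_le_pow_left hvN v).trans (Nat.pow_le_pow_right (h0.trans_le hvN) hvN)
  · rw [copyCount, ← Set.ncard_coe_finset]
    refine Set.ncard_le_ncard ?_ (Set.toFinite _)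
    intro G' hG'
    obtain ⟨z, hz, rfl⟩ := mem_image.1 (mem_coe.1 hG')
    have := (mem_filter.1 hz).2
    exact ⟨this.2, z, this.1.injOn, rfl⟩

/-- The tuples along which the pattern `F` occurs in `G`. -/
def patternTuples {k n : ℕ} (F : Pattern k) (G : SatFormula (Fin n)) :
    Finset (Fin (k + 1) → Fin n) :=
  univ.filter fun x => ∀ c ∈ F, clauseAlong x c.1 c.2 ∈ G

open scoped Classical in
/-- The tuples along which some bad pattern occurs in `G`. -/
noncomputable def badTuples {n : ℕ} (k : ℕ) (G : SatFormula (Fin n)) :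
    Finset (Fin (k + 1) → Fin n) :=
  (univ.filter fun F : Pattern k => F.IsBad).biUnion fun F => patternTuples F G

lemma mem_badTuples {k n : ℕ} {F : Pattern k} (hF : F.IsBad) {G : SatFormula (Fin n)}
    {x : Fin (k + 1) → Fin n} (hx : ∀ c ∈ F, clauseAlong x c.1 c.2 ∈ G) : x ∈ badTuples k G := by
  classical
  exact mem_biUnion.2 ⟨F, by simpa using hF, by simpa [patternTuples] using hx⟩

lemma card_doubled_patternTuples_le {k n : ℕ} {F : Pattern k} {G : SatFormula (Fin n)}
    {B : SatFormula (Fin (2 * (k + 1)))}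
    (hB : ∀ C ∈ B, ∃ c ∈ F, ∃ σ, C = dupClause σ c.1 c.2) :
    (doubled (patternTuples F G)).card ≤
      (univ.filter fun z : Fin (2 * (k + 1)) → Fin n =>
        Function.Injective z ∧ mapFormula z B ⊆ G).card +
      (univ.filter fun z : Fin (2 * (k + 1)) → Fin n => ¬ Function.Injective z).card := by
  refine le_trans ?_ (card_union_le _ _)
  refine card_le_card_of_injOn
    (fun z j => z ((dup k).symm j).1 ((dup k).symm j).2) ?_ ?_
  · intro z hz
    have hz := (mem_filter.1 (mem_coe.1 hz)).2
    simp only [coe_union, coe_filter, mem_univ, true_and, Set.mem_union, Set.mem_ofPred_eq]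
    by_cases hinj : Function.Injective fun j => z ((dup k).symm j).1 ((dup k).symm j).2
    · refine Or.inl ⟨hinj, ?_⟩
      intro C' hC'
      obtain ⟨C, hC, rfl⟩ := mem_image.1 hC'
      obtain ⟨c, hc, σ, rfl⟩ := hB C hC
      have := (mem_filter.1 (hz σ)).2 c hc
      rw [dupClause]
      beta_reduce
      rw [image_clauseAlong fun j => z ((dup k).symm j).1 ((dup k).symm j).2]
      convert this using 2
      funext i
      simp
    · exact Or.inr hinj
  · intro z _ z' _ h
    funext i b
    simpa using congrFun h (dup k (i, b))

lemma card_patternTuples_le {k : ℕ} {ε : ℝ} (hε : 0 < ε) :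
    ∃ δ₀ : ℝ, 0 < δ₀ ∧ ∃ n₀ : ℕ, ∀ n ≥ n₀, ∀ G : SatFormula (Fin n), ∀ δ ≤ δ₀,
      FewNonMinimal k n G δ → ∀ F : Pattern k, F.IsBad →
      ((patternTuples F G).card : ℝ) ≤ ε * n ^ (k + 1) := by
  set N := 2 * (k + 1) with hN
  set c := ε ^ (2 ^ (k + 1)) with hc
  have hc0 : 0 < c := by positivity
  have hN0 : (0 : ℝ) < N := by rw [hN]; positivity
  obtain ⟨n₁, hn₁⟩ := exists_nat_gt (2 * (N : ℝ) ^ 2 / c)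
  refine ⟨c / (2 * N ^ N), by positivity, n₁ + 1, ?_⟩
  intro n hn G δ hδ hG F hF
  have hn0 : (0 : ℝ) < n := by exact_mod_cast (Nat.succ_pos _).trans_le hn
  have hnn : 2 * (N : ℝ) ^ 2 / c ≤ n :=
    hn₁.le.trans (by exact_mod_cast (Nat.le_succ _).trans hn)
  obtain ⟨B, hBk, hBs, hBm, hB⟩ := hF
  have hvN : (formulaVars B).card ≤ N := by simpa using card_le_univ (formulaVars B)
  have h1 : ((doubled (patternTuples F G)).card : ℝ) ≤
      (N ^ N * n ^ (N - (formulaVars B).card)) * copyCount B G + N ^ 2 * n ^ (N - 1) := by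
    have := (card_doubled_patternTuples_le (G := G) hB).trans
      (add_le_add (card_maps_le_copyCount_mul B G) card_filter_not_injective_le)
    simp only [Fintype.card_fin] at this
    exact_mod_cast this
  have h2 : (N ^ N * (n : ℝ) ^ (N - (formulaVars B).card)) * copyCount B G ≤
      c / 2 * n ^ N := by
    calc (N ^ N * (n : ℝ) ^ (N - (formulaVars B).card)) * copyCount B G
        ≤ (N ^ N * (n : ℝ) ^ (N - (formulaVars B).card)) *
          (c / (2 * N ^ N) * n ^ (formulaVars B).card) := by
          gcongr
          exact (hG B hBk hBs hBm).trans (by gcongr)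
      _ = c / 2 * (n ^ (N - (formulaVars B).card) * n ^ (formulaVars B).card) := by
          field_simp
      _ = c / 2 * n ^ N := by rw [← pow_add, Nat.sub_add_cancel hvN]
  have h3 : (N : ℝ) ^ 2 * n ^ (N - 1) ≤ c / 2 * n ^ N := by
    have : (n : ℝ) ^ N = n * n ^ (N - 1) := by
      rw [← pow_succ']
      congr 1
    rw [this, ← mul_assoc]
    gcongr
    rw [div_le_iff₀ hc0] at hnn
    linarith
  have : Nonempty (Fin n) := ⟨⟨0, by exact_mod_cast hn0⟩⟩
  have h4 := density_pow_le_doubled (k + 1) (patternTuples F G)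
  rw [Fintype.card_fin] at h4
  have h5 : ((doubled (patternTuples F G)).card : ℝ) / n ^ N ≤ c := by
    rw [div_le_iff₀ (by positivity)]
    linarith
  have h6 := (pow_le_pow_iff_left₀ (by positivity) hε.le (by positivity)).1 (h4.trans h5)
  rwa [div_le_iff₀ (by positivity)] at h6

/-- Few simple non-minimal subformulae force few occurrences of bad patterns. -/
lemma card_badTuples_le {k : ℕ} {ε : ℝ} (hε : 0 < ε) :
    ∃ δ₀ : ℝ, 0 < δ₀ ∧ ∃ n₀ : ℕ, ∀ n ≥ n₀, ∀ G : SatFormula (Fin n), ∀ δ ≤ δ₀,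
      FewNonMinimal k n G δ → ((badTuples k G).card : ℝ) ≤ ε * n ^ (k + 1) := by
  classical
  set M := Fintype.card (Pattern k) with hM
  have hM0 : 0 < (M : ℝ) := by rw [hM]; exact_mod_cast Fintype.card_pos
  obtain ⟨δ₀, hδ₀, n₀, h⟩ := card_patternTuples_le (k := k) (ε := ε / M) (by positivity)
  refine ⟨δ₀, hδ₀, n₀, fun n hn G δ hδ hG => ?_⟩
  have h1 : ((badTuples k G).card : ℝ) ≤
      ∑ F ∈ univ.filter fun F : Pattern k => F.IsBad, ((patternTuples F G).card : ℝ) := by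
    exact_mod_cast card_biUnion_le
  refine h1.trans ((sum_le_card_nsmul _ _ (ε / M * n ^ (k + 1)) ?_).trans ?_)
  · intro F hF
    exact h n hn G δ hδ hG F (by simpa using hF)
  · rw [nsmul_eq_mul]
    calc _ ≤ (M : ℝ) * (ε / M * n ^ (k + 1)) := by
          gcongr
          exact_mod_cast card_le_univ _
      _ = ε * n ^ (k + 1) := by field_simp

end Supersaturation

section Types

variable {k n : ℕ} {G : SatFormula (Fin n)}

lemma pair_mem_badTuples (hG : IsKFormula k G) {x : Fin (k + 1) → Fin n}
    {T : Finset (Fin (k + 1))} (hT : T.card = k) {C C' : SatClause (Fin n)} (hC : C ∈ G)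
    (hC' : C' ∈ G) (hCT : clauseVars C = T.image x) (hCT' : clauseVars C' = T.image x)
    (hdiff : 2 ≤ (C \ C').card) : x ∈ badTuples k G := by
  obtain ⟨p, rfl⟩ := exists_eq_clauseAlong (hG C hC) hCT
  obtain ⟨q, rfl⟩ := exists_eq_clauseAlong (hG C' hC') hCT'
  have key : ∀ l ∈ clauseAlong x T p \ clauseAlong x T q,
      ∃ a ∈ T, l = (x a, p a) ∧ p a ≠ q a := by
    intro l hl
    obtain ⟨hl1, hl2⟩ := mem_sdiff.1 hl
    obtain ⟨a, ha, rfl⟩ := mem_image.1 hl1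
    refine ⟨a, ha, rfl, fun h => hl2 ?_⟩
    rw [h]
    exact mem_image_of_mem (fun i => (x i, q i)) ha
  obtain ⟨l, hl, l', hl', hne⟩ := one_lt_card.1 hdiff
  obtain ⟨a, ha, rfl, hpa⟩ := key l hl
  obtain ⟨b, hb, rfl, hpb⟩ := key l' hl'
  have hab : a ≠ b := by
    rintro rfl
    exact hne rfl
  refine mem_badTuples (isBad_pair hT ha hb hab hpa hpb) ?_
  intro c hc
  rcases mem_insert.1 hc with rfl | hc
  · exact hC
  · rw [mem_singleton.1 hc]
    exact hC'

lemma triple_mem_badTuples (hG : IsKFormula k G) {x : Fin (k + 1) → Fin n}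
    (hx : Function.Injective x) {v a b : Fin (k + 1)} (hva : v ≠ a) (hvb : v ≠ b) (hab : a ≠ b)
    {P Q R : SatClause (Fin n)} (hP : P ∈ G) (hQ : Q ∈ G) (hR : R ∈ G)
    (hPv : clauseVars P = (univ.erase v).image x) (hQa : clauseVars Q = (univ.erase a).image x)
    (hRb : clauseVars R = (univ.erase b).image x) {s t : Bool} (hst : s ≠ t)
    (hs : (x v, s) ∈ Q) (ht : (x v, t) ∈ R) : x ∈ badTuples k G := by
  obtain ⟨p, rfl⟩ := exists_eq_clauseAlong (hG P hP) hPv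
  obtain ⟨q, rfl⟩ := exists_eq_clauseAlong (hG Q hQ) hQa
  obtain ⟨r, rfl⟩ := exists_eq_clauseAlong (hG R hR) hRb
  rw [mem_clauseAlong_of_injOn hx.injOn (by simp [hva])] at hs
  rw [mem_clauseAlong_of_injOn hx.injOn (by simp [hvb])] at ht
  refine mem_badTuples (isBad_triple hva hvb hab (p := p) (q := q) (r := r)
    (by rw [← hs, ← ht]; exact hst)) ?_
  intro c hc
  simp only [mem_insert, mem_singleton] at hc
  rcases hc with rfl | rfl | rfl
  · exact hP
  · exact hQ
  · exact hR

/-- The clauses of `G` on the variable set `S`. -/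
def clausesOn (G : SatFormula (Fin n)) (S : Finset (Fin n)) : SatFormula (Fin n) :=
  G.filter fun C => clauseVars C = S

/-- The variable set `S` supports two clauses differing in at least two variables. -/
def Conflicted (G : SatFormula (Fin n)) (S : Finset (Fin n)) : Prop :=
  ∃ C ∈ clausesOn G S, ∃ C' ∈ clausesOn G S, 2 ≤ (C \ C').card

instance : DecidablePred (Conflicted G) := fun _ => by
  unfold Conflicted
  infer_instance

lemma mem_clausesOn {S : Finset (Fin n)} {C : SatClause (Fin n)} :
    C ∈ clausesOn G S ↔ C ∈ G ∧ clauseVars C = S := mem_filter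

lemma exists_differ (hG : IsKFormula k G) {S : Finset (Fin n)} {C C' : SatClause (Fin n)}
    (hC : C ∈ clausesOn G S) (hC' : C' ∈ clausesOn G S) (hne : C ≠ C') :
    ∃ v s, (v, s) ∈ C ∧ (v, !s) ∈ C' := by
  rw [mem_clausesOn] at hC hC'
  have hsub : ¬ C ⊆ C' := fun h =>
    hne (eq_of_subset_of_card_le h ((hG C' hC'.1).1.trans (hG C hC.1).1.symm).le)
  obtain ⟨⟨v, s⟩, hvs, hn⟩ := not_subset.1 hsub
  refine ⟨v, s, hvs, ?_⟩
  have : v ∈ clauseVars C' := by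
    rw [hC'.2, ← hC.2]
    exact mem_clauseVars.2 ⟨s, hvs⟩
  obtain ⟨t, ht⟩ := mem_clauseVars.1 this
  have : t = !s := by
    cases s <;> cases t <;> simp_all
  rwa [← this]

lemma differ_unique (hG : IsKFormula k G) {S : Finset (Fin n)} (hS : ¬ Conflicted G S)
    {C C' : SatClause (Fin n)} (hC : C ∈ clausesOn G S) (hC' : C' ∈ clausesOn G S)
    {v w : Fin n} {s t : Bool} (hv : (v, s) ∈ C) (hv' : (v, !s) ∈ C')
    (hw : (w, t) ∈ C) (hw' : (w, !t) ∈ C') : v = w := by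
  by_contra hvw
  refine hS ⟨C, hC, C', hC', one_lt_card.2 ⟨(v, s), ?_, (w, t), ?_, by simp [hvw]⟩⟩
  · refine mem_sdiff.2 ⟨hv, fun h => ?_⟩
    have := polarity_unique (hG C' (mem_clausesOn.1 hC').1) h hv'
    simp at this
  · refine mem_sdiff.2 ⟨hw, fun h => ?_⟩
    have := polarity_unique (hG C' (mem_clausesOn.1 hC').1) h hw'
    simp at this

lemma card_clausesOn_le_two (hG : IsKFormula k G) {S : Finset (Fin n)}
    (hS : ¬ Conflicted G S) : (clausesOn G S).card ≤ 2 := by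
  by_contra hlt
  obtain ⟨C₁, C₂, C₃, h1, h2, h3, h12, h13, h23⟩ := two_lt_card_iff.1 (not_le.1 hlt)
  obtain ⟨v, s, hv1, hv2⟩ := exists_differ hG h1 h2 h12
  obtain ⟨w, t, hw1, hw3⟩ := exists_differ hG h1 h3 h13
  obtain ⟨z, u, hz2, hz3⟩ := exists_differ hG h2 h3 h23
  have hpol : ∀ {C}, C ∈ clausesOn G S → ∀ {y a b}, (y, a) ∈ C → (y, b) ∈ C → a = b :=
    fun hC => polarity_unique (hG _ (mem_clausesOn.1 hC).1)
  have hvars : ∀ {C}, C ∈ clausesOn G S → ∀ {y}, y ∈ S → ∃ a, (y, a) ∈ C := by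
    intro C hC y hy
    exact mem_clauseVars.1 ((mem_clausesOn.1 hC).2.symm ▸ hy)
  have hzS : z ∈ S := (mem_clausesOn.1 h2).2 ▸ mem_clauseVars.2 ⟨u, hz2⟩
  have hvS : v ∈ S := (mem_clausesOn.1 h1).2 ▸ mem_clauseVars.2 ⟨s, hv1⟩
  have hwS : w ∈ S := (mem_clausesOn.1 h1).2 ▸ mem_clauseVars.2 ⟨t, hw1⟩
  obtain ⟨a, ha⟩ := hvars h3 hvS
  obtain ⟨b, hb⟩ := hvars h2 hwS
  by_cases hvw : v = w
  · subst hvw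
    have hst := hpol h1 hv1 hw1
    subst hst
    obtain ⟨c, hc⟩ := hvars h1 hzS
    by_cases hcu : c = u
    · subst hcu
      have := differ_unique hG hS h1 h3 hc hz3 hv1 hw3
      subst this
      have := hpol h2 hz2 hv2
      have := hpol h1 hc hv1
      simp_all
    · have hcu' : u = !c := by revert hcu; cases c <;> cases u <;> simp
      subst hcu'
      have := differ_unique hG hS h1 h2 hc hz2 hv1 hv2
      subst this
      have := hpol h1 hc hv1
      subst this
      have := hpol h3 hz3 hw3
      simp at this
  · have ha' : a = s := by
      by_contra h
      have : a = !s := by revert h; cases a <;> cases s <;> simp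
      exact hvw (differ_unique hG hS h1 h3 hv1 (this ▸ ha) hw1 hw3)
    have hb' : b = t := by
      by_contra h
      have : b = !t := by revert h; cases b <;> cases t <;> simp
      exact hvw (differ_unique hG hS h1 h2 hv1 hv2 hw1 (this ▸ hb))
    subst ha' hb'
    exact hvw (differ_unique hG hS h2 h3 hv2 (by simpa using ha) hb hw3)

/-- The partially directed graph recording the variable sets of `G` without conflicts: undirected
edges support a single clause, directed edges support two clauses differing in their head. -/
def typeGraph (k : ℕ) (G : SatFormula (Fin n)) : PDG (Fin n) where
  undir := (univ.powersetCard k).filter fun S => (clausesOn G S).card = 1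
  dir := (univ.powersetCard k ×ˢ univ).filter fun e => ¬ Conflicted G e.1 ∧
    ∃ C ∈ clausesOn G e.1, ∃ C' ∈ clausesOn G e.1, (e.2, true) ∈ C ∧ (e.2, false) ∈ C'

lemma typeGraph_isValid (hG : IsKFormula k G) : (typeGraph k G).IsValid k := by
  have hdir : ∀ {e}, e ∈ (typeGraph k G).dir → e.1.card = k ∧ ¬ Conflicted G e.1 ∧
      ∃ C ∈ clausesOn G e.1, ∃ C' ∈ clausesOn G e.1, (e.2, true) ∈ C ∧ (e.2, false) ∈ C' := by
    intro e he
    simpa [typeGraph] using he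
  have hne : ∀ {S v C C'}, C ∈ clausesOn G S → (v, true) ∈ C → (v, false) ∈ C' → C ≠ C' := by
    rintro S v C C' hC hv hv' rfl
    have := polarity_unique (hG _ (mem_clausesOn.1 hC).1) hv hv'
    simp at this
  refine ⟨fun e he => ?_, fun e he => ?_, fun e he => ?_, fun e he f hf hef => ?_⟩
  · exact (mem_powersetCard.1 (mem_filter.1 he).1).2
  · obtain ⟨hk, -, C, hC, -, -, hv, -⟩ := hdir he
    exact ⟨hk, (mem_clausesOn.1 hC).2 ▸ mem_clauseVars.2 ⟨_, hv⟩⟩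
  · obtain ⟨-, -, C, hC, C', hC', hv, hv'⟩ := hdir he
    intro hu
    have h1 := (mem_filter.1 hu).2
    exact hne hC hv hv' (card_le_one.1 h1.le _ hC _ hC')
  · obtain ⟨S, v⟩ := e
    obtain ⟨S', w⟩ := f
    obtain rfl : S = S' := hef
    obtain ⟨-, hS, C, hC, C', hC', hv, hv'⟩ := hdir he
    obtain ⟨-, -, D, hD, D', hD', hw, hw'⟩ := hdir hf
    have hCC := hne hC hv hv'
    have hDD := hne hD hw hw'
    have h2 : clausesOn G S = {C, C'} := by
      symm
      refine eq_of_subset_of_card_le ?_ ?_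
      · intro E hE
        rcases mem_insert.1 hE with rfl | hE
        · exact hC
        · exact mem_singleton.1 hE ▸ hC'
      · rw [card_pair hCC]
        exact card_clausesOn_le_two hG hS
    simp only at hD hD'
    have hD2 := hD
    have hD2' := hD'
    rw [h2, mem_insert, mem_singleton] at hD2 hD2'
    have : v = w := by
      rcases hD2 with rfl | rfl <;> rcases hD2' with rfl | rfl
      · exact absurd rfl hDD
      · exact differ_unique hG hS hC hC' hv hv' hw hw'
      · exact differ_unique hG hS hC hC' hv hv' hw' hw
      · exact absurd rfl hDD
    rw [this]

lemma exists_clause_of_mem_undir {S : Finset (Fin n)} (hS : S ∈ (typeGraph k G).undir) :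
    ∃ C ∈ G, clauseVars C = S := by
  have := (mem_filter.1 hS).2
  obtain ⟨C, hC⟩ := card_pos.1 (this ▸ Nat.one_pos)
  exact ⟨C, mem_clausesOn.1 hC⟩

lemma exists_clause_of_mem_dir {S : Finset (Fin n)} {v : Fin n}
    (hS : (S, v) ∈ (typeGraph k G).dir) (s : Bool) :
    ∃ C ∈ G, clauseVars C = S ∧ (v, s) ∈ C := by
  obtain ⟨-, C, hC, C', hC', hv, hv'⟩ := (mem_filter.1 hS).2
  cases s
  · exact ⟨C', (mem_clausesOn.1 hC').1, (mem_clausesOn.1 hC').2, hv'⟩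
  · exact ⟨C, (mem_clausesOn.1 hC).1, (mem_clausesOn.1 hC).2, hv⟩

/-- Copies of `T_k` in the type graph are bad. -/
lemma mem_badTuples_of_embeds (hk : 2 ≤ k) (hG : IsKFormula k G) {x : Fin (k + 1) → Fin n}
    (hx : Function.Injective x)
    (hu : ∀ e ∈ (TkPDG k).undir, e.image x ∈ (typeGraph k G).undir ∨
      ∃ v, (e.image x, v) ∈ (typeGraph k G).dir)
    (hd : ∀ p ∈ (TkPDG k).dir, (p.1.image x, x p.2) ∈ (typeGraph k G).dir) :
    x ∈ badTuples k G := by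
  have hcl : ∀ e ∈ (TkPDG k).undir, ∃ C ∈ G, clauseVars C = e.image x := by
    intro e he
    rcases hu e he with h | ⟨v, h⟩
    · exact exists_clause_of_mem_undir h
    · obtain ⟨C, hC, hv, -⟩ := exists_clause_of_mem_dir h true
      exact ⟨C, hC, hv⟩
  obtain ⟨P, hP, hPv⟩ := hcl (univ.erase ⟨k, Nat.lt_succ_self k⟩) (by simp [TkPDG])
  obtain ⟨Q, hQ, hQv⟩ := hcl (univ.erase ⟨k - 2, by omega⟩) (by simp [TkPDG])
  have hd' := hd (univ.erase ⟨k - 1, by omega⟩, ⟨k, Nat.lt_succ_self k⟩) (by simp [TkPDG])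
  have hva : (⟨k, Nat.lt_succ_self k⟩ : Fin (k + 1)) ≠ ⟨k - 2, by omega⟩ := by
    simp only [ne_eq, Fin.mk.injEq]; omega
  have hvb : (⟨k, Nat.lt_succ_self k⟩ : Fin (k + 1)) ≠ ⟨k - 1, by omega⟩ := by
    simp only [ne_eq, Fin.mk.injEq]; omega
  have hab : (⟨k - 2, by omega⟩ : Fin (k + 1)) ≠ ⟨k - 1, by omega⟩ := by
    simp only [ne_eq, Fin.mk.injEq]; omega
  have hvQ : x ⟨k, Nat.lt_succ_self k⟩ ∈ clauseVars Q := by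
    rw [hQv]
    exact mem_image_of_mem x (by simp [hva])
  obtain ⟨s, hs⟩ := mem_clauseVars.1 hvQ
  obtain ⟨R, hR, hRv, ht⟩ := exists_clause_of_mem_dir hd' (!s)
  exact triple_mem_badTuples hG hx hva hvb hab hP hQ hR hPv hQv hRv (t := !s) (by simp) hs ht

end Types

section Sampling

lemma card_powersetCard_filter_superset {n m s : ℕ} (hsm : s ≤ m) {S : Finset (Fin n)}
    (hS : S.card = s) :
    (((univ : Finset (Fin n)).powersetCard m).filter (S ⊆ ·)).card =
      (n - s).choose (m - s) := by
  have hc : (univ \ S : Finset (Fin n)).card = n - s := by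
    rw [card_sdiff_of_subset (subset_univ _), hS, card_univ, Fintype.card_fin]
  rw [← hc, ← card_powersetCard]
  refine card_bij' (fun M _ => M \ S) (fun M _ => M ∪ S) ?_ ?_ ?_ ?_
  · intro M hM
    obtain ⟨h1, h2⟩ := mem_filter.1 hM
    rw [mem_powersetCard]
    refine ⟨sdiff_subset_sdiff (subset_univ _) Subset.rfl, ?_⟩
    rw [card_sdiff_of_subset h2, (mem_powersetCard.1 h1).2, hS]
  · intro M hM
    obtain ⟨h1, h2⟩ := mem_powersetCard.1 hM
    rw [mem_filter, mem_powersetCard]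
    refine ⟨⟨subset_univ _, ?_⟩, subset_union_right⟩
    rw [card_union_of_disjoint, h2, hS]
    · omega
    · exact disjoint_of_subset_left h1 sdiff_disjoint
  · intro M hM
    exact sdiff_union_of_subset (mem_filter.1 hM).2
  · intro M hM
    rw [union_sdiff_right, sdiff_eq_self_of_disjoint]
    exact disjoint_of_subset_left (mem_powersetCard.1 hM).1 sdiff_disjoint

/-- The partially directed graph induced along a map of vertices. -/
def comapPDG {m n : ℕ} (ι : Fin m → Fin n) (H : PDG (Fin n)) : PDG (Fin m) where
  undir := univ.filter fun e => e.image ι ∈ H.undir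
  dir := univ.filter fun p => (p.1.image ι, ι p.2) ∈ H.dir

lemma comapPDG_isValid {k m n : ℕ} {ι : Fin m → Fin n} (hι : Function.Injective ι)
    {H : PDG (Fin n)} (hH : H.IsValid k) : (comapPDG ι H).IsValid k := by
  obtain ⟨h1, h2, h3, h4⟩ := hH
  refine ⟨fun e he => ?_, fun p hp => ?_, fun p hp hu => ?_, fun p hp q hq hpq => ?_⟩
  · rw [← card_image_of_injective e hι]
    exact h1 _ (mem_filter.1 he).2
  · have := h2 _ (mem_filter.1 hp).2
    refine ⟨by rw [← card_image_of_injective p.1 hι]; exact this.1, ?_⟩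
    obtain ⟨a, ha, hab⟩ := mem_image.1 this.2
    exact hι hab ▸ ha
  · exact h3 _ (mem_filter.1 hp).2 (mem_filter.1 hu).2
  · have := h4 _ (mem_filter.1 hp).2 _ (mem_filter.1 hq).2 (congrArg (Finset.image ι) hpq)
    exact Prod.ext hpq (hι (Prod.ext_iff.1 this).2)

lemma card_comapPDG {k m n : ℕ} {M : Finset (Fin n)} (hM : M.card = m) {H : PDG (Fin n)}
    (hH : H.IsValid k) :
    (comapPDG (M.orderEmbOfFin hM) H).undir.card = (H.undir.filter (· ⊆ M)).card ∧
    (comapPDG (M.orderEmbOfFin hM) H).dir.card = (H.dir.filter (·.1 ⊆ M)).card := by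
  set ι : Fin m → Fin n := ⇑(M.orderEmbOfFin hM) with hι
  have hinj : Function.Injective ι := (M.orderEmbOfFin hM).injective
  have hmem : ∀ i, ι i ∈ M := fun i => orderEmbOfFin_mem M hM i
  have himage : univ.image ι = M := by
    refine eq_of_subset_of_card_le (fun y hy => ?_) ?_
    · obtain ⟨i, -, rfl⟩ := mem_image.1 hy
      exact hmem i
    · rw [card_image_of_injective _ hinj, hM]; simp
  have hpre : ∀ S ⊆ M, ∃ e : Finset (Fin m), e.image ι = S := by
    intro S hS
    refine ⟨univ.filter (ι · ∈ S), ?_⟩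
    ext y
    simp only [mem_image, mem_filter, mem_univ, true_and]
    constructor
    · rintro ⟨i, hi, rfl⟩
      exact hi
    · intro hy
      obtain ⟨i, -, rfl⟩ := mem_image.1 (himage.symm ▸ hS hy)
      exact ⟨i, hy, rfl⟩
  have himg : ∀ e : Finset (Fin m), e.image ι ⊆ M := by
    intro e y hy
    obtain ⟨i, -, rfl⟩ := mem_image.1 hy
    exact hmem i
  constructor
  · refine card_bij (fun e _ => e.image ι) ?_ ?_ ?_
    · intro e he
      exact mem_filter.2 ⟨(mem_filter.1 he).2, himg e⟩
    · intro e _ e' _ h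
      exact image_injective hinj h
    · intro S hS
      obtain ⟨hS1, hS2⟩ := mem_filter.1 hS
      obtain ⟨e, rfl⟩ := hpre S hS2
      exact ⟨e, mem_filter.2 ⟨mem_univ _, hS1⟩, rfl⟩
  · refine card_bij (fun p _ => (p.1.image ι, ι p.2)) ?_ ?_ ?_
    · intro p hp
      exact mem_filter.2 ⟨(mem_filter.1 hp).2, himg p.1⟩
    · intro p _ q _ h
      obtain ⟨h1, h2⟩ := Prod.ext_iff.1 h
      exact Prod.ext (image_injective hinj h1) (hinj h2)
    · rintro ⟨S, v⟩ hS
      obtain ⟨hS1, hS2⟩ := mem_filter.1 hS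
      obtain ⟨e, rfl⟩ := hpre S hS2
      obtain ⟨i, -, rfl⟩ := mem_image.1 (hH.2.1 _ hS1).2
      exact ⟨(e, i), mem_filter.2 ⟨mem_univ _, hS1⟩, rfl⟩

lemma card_undir_add_card_dir_le {k m : ℕ} {H : PDG (Fin m)} (hH : H.IsValid k) :
    H.undir.card + H.dir.card ≤ m.choose k := by
  obtain ⟨h1, h2, h3, h4⟩ := hH
  have hd : H.dir.card = (H.dir.image Prod.fst).card := by
    rw [card_image_of_injOn]
    intro p hp q hq h
    exact h4 p hp q hq h
  rw [hd, ← card_union_of_disjoint]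
  · calc _ ≤ ((univ : Finset (Fin m)).powersetCard k).card := by
          refine card_le_card fun e he => mem_powersetCard.2 ⟨subset_univ _, ?_⟩
          rcases mem_union.1 he with he | he
          · exact h1 e he
          · obtain ⟨p, hp, rfl⟩ := mem_image.1 he
            exact (h2 p hp).1
      _ = m.choose k := by simp
  · rw [disjoint_left]
    intro e he he'
    obtain ⟨p, hp, rfl⟩ := mem_image.1 he'
    exact h3 p hp he

/-- A Turán bound on `m` vertices transfers to larger graphs with few copies of the forbidden
graph. -/
lemma turan_of_few_copies {k m n : ℕ} {θ δ' : ℝ} (hθ : 1 ≤ θ) (hδ' : 0 ≤ δ')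
    (hm : ∀ H : PDG (Fin m), H.IsValid k → ¬ (TkPDG k).IsSubgraph H →
      (H.undir.card : ℝ) + θ * H.dir.card ≤ (1 + δ') * m.choose k)
    (hkm : k + 1 ≤ m) (hmn : m ≤ n) {H : PDG (Fin n)} (hH : H.IsValid k)
    {X : Finset (Fin (k + 1) → Fin n)}
    (hX : ∀ x : Fin (k + 1) → Fin n, Function.Injective x →
      (∀ e ∈ (TkPDG k).undir, e.image x ∈ H.undir ∨ ∃ v, (e.image x, v) ∈ H.dir) →
      (∀ p ∈ (TkPDG k).dir, (p.1.image x, x p.2) ∈ H.dir) → x ∈ X) :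
    (H.undir.card : ℝ) + θ * H.dir.card ≤
      (1 + δ' + θ * (X.card * m.choose (k + 1) / n.choose (k + 1))) * n.choose k := by
  set 𝓜 := (univ : Finset (Fin n)).powersetCard m with h𝓜
  set Y := X.filter Function.Injective with hY
  have hlocal : ∀ M ∈ 𝓜, ((H.undir.filter (· ⊆ M)).card : ℝ) +
      θ * (H.dir.filter (·.1 ⊆ M)).card ≤
      (1 + δ') * m.choose k + θ * m.choose k * (Y.filter (univ.image · ⊆ M)).card := by
    intro M hM
    have hMc := (mem_powersetCard.1 hM).2
    set ι : Fin m → Fin n := ⇑(M.orderEmbOfFin hMc) with hι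
    have hinj : Function.Injective ι := (M.orderEmbOfFin hMc).injective
    have hval := comapPDG_isValid hinj hH
    obtain ⟨hu, hd⟩ := card_comapPDG hMc hH
    rw [← hu, ← hd]
    by_cases hsub : (TkPDG k).IsSubgraph (comapPDG ι H)
    · obtain ⟨φ, hφ, h1, h2⟩ := hsub
      have hxY : ι ∘ φ ∈ Y.filter (univ.image · ⊆ M) := by
        refine mem_filter.2 ⟨mem_filter.2 ⟨hX _ (hinj.comp hφ) ?_ ?_, hinj.comp hφ⟩, ?_⟩
        · intro e he
          rw [← image_image]
          rcases h1 e he with h | ⟨v, h⟩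
          · exact Or.inl (mem_filter.1 h).2
          · exact Or.inr ⟨ι v, (mem_filter.1 h).2⟩
        · intro p hp
          rw [← image_image]
          exact (mem_filter.1 (h2 p hp)).2
        · intro y hy
          obtain ⟨i, -, rfl⟩ := mem_image.1 hy
          exact orderEmbOfFin_mem M hMc _
      have h1Y : (1 : ℝ) ≤ (Y.filter (univ.image · ⊆ M)).card := by
        exact_mod_cast card_pos.2 ⟨_, hxY⟩
      have htot : ((comapPDG ι H).undir.card : ℝ) + (comapPDG ι H).dir.card ≤ m.choose k := by
        exact_mod_cast card_undir_add_card_dir_le hval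
      have hu0 : (0 : ℝ) ≤ (comapPDG ι H).undir.card := by positivity
      have hc0 : (0 : ℝ) ≤ m.choose k := by positivity
      calc ((comapPDG ι H).undir.card : ℝ) + θ * (comapPDG ι H).dir.card
          ≤ θ * m.choose k * 1 := by nlinarith
        _ ≤ θ * m.choose k * (Y.filter (univ.image · ⊆ M)).card := by gcongr
        _ ≤ _ := le_add_of_nonneg_left (by positivity)
    · exact (hm _ hval hsub).trans (le_add_of_nonneg_right (by positivity))
  have hkm' : k ≤ m := by omega
  set a := (n - k).choose (m - k) with ha
  set b := (n - (k + 1)).choose (m - (k + 1)) with hb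
  have hsumU : ∑ M ∈ 𝓜, (H.undir.filter (· ⊆ M)).card = a * H.undir.card := by
    simp_rw [card_filter]
    rw [sum_comm]
    simp_rw [← card_filter]
    rw [sum_congr rfl fun S hS => card_powersetCard_filter_superset hkm' (hH.1 S hS)]
    rw [sum_const, smul_eq_mul, mul_comm]
  have hsumD : ∑ M ∈ 𝓜, (H.dir.filter (·.1 ⊆ M)).card = a * H.dir.card := by
    simp_rw [card_filter]
    rw [sum_comm]
    simp_rw [← card_filter]
    rw [sum_congr rfl fun p hp => card_powersetCard_filter_superset hkm' (hH.2.1 p hp).1]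
    rw [sum_const, smul_eq_mul, mul_comm]
  have hsumY : ∑ M ∈ 𝓜, (Y.filter (univ.image · ⊆ M)).card = b * Y.card := by
    simp_rw [card_filter]
    rw [sum_comm]
    simp_rw [← card_filter]
    rw [sum_congr rfl fun x hx => card_powersetCard_filter_superset hkm
      ((card_image_of_injective _ (mem_filter.1 hx).2).trans (by simp))]
    rw [sum_const, smul_eq_mul, mul_comm]
  have hsum := sum_le_sum hlocal
  simp only [sum_add_distrib, ← mul_sum] at hsum
  rw [sum_const, nsmul_eq_mul, card_powersetCard, card_univ, Fintype.card_fin] at hsum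
  have hU' : ∑ M ∈ 𝓜, ((H.undir.filter (· ⊆ M)).card : ℝ) = a * H.undir.card := by
    exact_mod_cast hsumU
  have hD' : ∑ M ∈ 𝓜, ((H.dir.filter (·.1 ⊆ M)).card : ℝ) = a * H.dir.card := by
    exact_mod_cast hsumD
  have hY' : ∑ M ∈ 𝓜, ((Y.filter (univ.image · ⊆ M)).card : ℝ) = b * Y.card := by
    exact_mod_cast hsumY
  rw [hU', hD', hY'] at hsum
  have ha0 : (0 : ℝ) < a := by exact_mod_cast Nat.choose_pos (by omega)
  have hN0 : (0 : ℝ) < n.choose (k + 1) := by exact_mod_cast Nat.choose_pos (by omega)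
  have e1 : (n.choose m : ℝ) * m.choose k = n.choose k * a := by
    exact_mod_cast Nat.choose_mul hkm'
  have e2 : (n.choose m : ℝ) * m.choose (k + 1) = n.choose (k + 1) * b := by
    exact_mod_cast Nat.choose_mul hkm
  have hYX : (Y.card : ℝ) ≤ X.card := by exact_mod_cast card_filter_le _ _
  have hb' : (b : ℝ) = n.choose m * m.choose (k + 1) / n.choose (k + 1) := by
    rw [e2]; field_simp
  refine le_of_mul_le_mul_left ?_ ha0
  calc (a : ℝ) * (H.undir.card + θ * H.dir.card)
      = a * H.undir.card + θ * (a * H.dir.card) := by ring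
    _ ≤ n.choose m * ((1 + δ') * m.choose k) + θ * m.choose k * (b * Y.card) := by
        linarith
    _ ≤ n.choose m * ((1 + δ') * m.choose k) + θ * m.choose k * (b * X.card) := by gcongr
    _ = (n.choose m * m.choose k) *
        (1 + δ' + θ * (X.card * m.choose (k + 1) / n.choose (k + 1))) := by
        rw [hb']; ring
    _ = _ := by rw [e1]; ring

end Sampling

section Missing

variable {k n : ℕ} {G : SatFormula (Fin n)}

lemma card_conflicted_mul_le (hG : IsKFormula k G) :
    (((univ : Finset (Fin n)).powersetCard k).filter (Conflicted G)).card * n ≤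
      (badTuples k G).card := by
  have h : ((((univ : Finset (Fin n)).powersetCard k).filter (Conflicted G)) ×ˢ
      (univ : Finset (Fin n))).card ≤ (badTuples k G).card := by
    refine card_le_card_of_surjOn
      (fun x => ((univ.erase (Fin.last k)).image x, x (Fin.last k))) ?_
    rintro ⟨S, w⟩ hSw
    obtain ⟨hS, -⟩ := mem_product.1 (mem_coe.1 hSw)
    obtain ⟨hSk, C, hC, C', hC', hdiff⟩ := mem_filter.1 hS
    have hSk := (mem_powersetCard.1 hSk).2
    have himage : (univ.erase (Fin.last k)).image
        (Fin.snoc (S.orderEmbOfFin hSk) w : Fin (k + 1) → Fin n) = S := by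
      refine eq_of_subset_of_card_le (fun y hy => ?_) ?_
      · obtain ⟨i, hi, rfl⟩ := mem_image.1 hy
        obtain ⟨j, rfl⟩ := Fin.exists_castSucc_eq.2 (mem_erase.1 hi).1
        rw [Fin.snoc_castSucc]
        exact orderEmbOfFin_mem S hSk j
      · rw [card_image_of_injOn]
        · simp [hSk]
        · intro i hi j hj hij
          obtain ⟨i, rfl⟩ := Fin.exists_castSucc_eq.2 (mem_erase.1 hi).1
          obtain ⟨j, rfl⟩ := Fin.exists_castSucc_eq.2 (mem_erase.1 hj).1
          simp only [Fin.snoc_castSucc] at hij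
          rw [(S.orderEmbOfFin hSk).injective hij]
    refine ⟨Fin.snoc (S.orderEmbOfFin hSk) w, ?_, by simp [himage]⟩
    rw [mem_clausesOn] at hC hC'
    exact pair_mem_badTuples hG (T := univ.erase (Fin.last k)) (by simp) hC.1 hC'.1
      (hC.2.trans himage.symm) (hC'.2.trans himage.symm) hdiff
  simpa [card_product] using h

lemma card_clausesOn_le {S : Finset (Fin n)} (hS : S.card = k) :
    (clausesOn G S).card ≤ 2 ^ (2 * k) := by
  calc (clausesOn G S).card ≤ (S ×ˢ (univ : Finset Bool)).powerset.card := by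
        refine card_le_card fun C hC => mem_powerset.2 fun l hl => ?_
        rw [← (mem_clausesOn.1 hC).2]
        exact mem_product.2 ⟨mem_image_of_mem _ hl, mem_univ _⟩
    _ = 2 ^ (2 * k) := by
        rw [card_powerset, card_product, hS, card_univ, Fintype.card_bool, mul_comm]

lemma logb_card_clausesOn_le (hG : IsKFormula k G) {S : Finset (Fin n)} (hS : S.card = k) :
    Real.logb 2 (((clausesOn G S).card : ℝ) + 1) ≤
      (if (clausesOn G S).card = 1 then 1 else 0) +
      Real.logb 2 3 * (if ¬ Conflicted G S ∧ (clausesOn G S).card = 2 then 1 else 0) +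
      (2 * k + 1) * (if Conflicted G S then 1 else 0) := by
  by_cases hc : Conflicted G S
  · have h1 : Real.logb 2 (((clausesOn G S).card : ℝ) + 1) ≤ 2 * k + 1 := by
      rw [Real.logb_le_iff_le_rpow (by norm_num) (by positivity)]
      have h2 : ((clausesOn G S).card : ℝ) ≤ 2 ^ (2 * k) := by
        exact_mod_cast card_clausesOn_le hS
      have h3 : (1 : ℝ) ≤ 2 ^ (2 * k) := one_le_pow₀ (by norm_num)
      have h4 : (2 : ℝ) ^ ((2 : ℝ) * k + 1) = 2 ^ (2 * k) * 2 := by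
        rw [← pow_succ]
        exact_mod_cast Real.rpow_natCast 2 (2 * k + 1)
      linarith
    simp only [hc, not_true_eq_false, false_and, if_false, if_true, mul_zero, mul_one, add_zero]
    split_ifs <;> linarith
  · have h2 := card_clausesOn_le_two hG hc
    interval_cases h : (clausesOn G S).card
    · simp [hc]
    · norm_num [hc]
    · norm_num [hc]

lemma card_two_clauses_le (hG : IsKFormula k G) :
    (((univ : Finset (Fin n)).powersetCard k).filter
      fun S => ¬ Conflicted G S ∧ (clausesOn G S).card = 2).card ≤ (typeGraph k G).dir.card := by
  refine le_trans (card_le_card fun S hS => ?_)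
    (card_image_le (s := (typeGraph k G).dir) (f := Prod.fst))
  obtain ⟨hSk, hc, h2⟩ := mem_filter.1 hS
  obtain ⟨C, C', hne, hCC⟩ := card_eq_two.1 h2
  have hC : C ∈ clausesOn G S := by simp [hCC]
  have hC' : C' ∈ clausesOn G S := by simp [hCC]
  obtain ⟨v, s, hv, hv'⟩ := exists_differ hG hC hC' hne
  refine mem_image.2 ⟨(S, v), mem_filter.2 ⟨mem_product.2 ⟨hSk, mem_univ _⟩, hc, ?_⟩, rfl⟩
  cases s
  · exact ⟨C', hC', C, hC, hv', hv⟩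
  · exact ⟨C, hC, C', hC', hv, hv'⟩

/-- The `k`-sets supporting no clause. -/
def missingSets (k : ℕ) (G : SatFormula (Fin n)) : Finset (Finset (Fin n)) :=
  (univ.powersetCard k).filter fun S => clausesOn G S = ∅

lemma formulaWt_mul_le (hG : IsKFormula k G) (hkn : k ≤ n) :
    formulaWt k n G * n.choose k ≤ (typeGraph k G).undir.card +
      Real.logb 2 3 * (typeGraph k G).dir.card + (2 * k + 1) *
      (((univ : Finset (Fin n)).powersetCard k).filter (Conflicted G)).card := by
  have hN : (n.choose k : ℝ) ≠ 0 := by exact_mod_cast (Nat.choose_pos hkn).ne'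
  have hL : 0 ≤ Real.logb 2 3 := Real.logb_nonneg (by norm_num) (by norm_num)
  have h2 : ((((univ : Finset (Fin n)).powersetCard k).filter
      fun S => ¬ Conflicted G S ∧ (clausesOn G S).card = 2).card : ℝ) ≤
      (typeGraph k G).dir.card := by exact_mod_cast card_two_clauses_le hG
  rw [formulaWt, div_mul_cancel₀ _ hN]
  calc _ ≤ _ := sum_le_sum fun S hS => logb_card_clausesOn_le hG (mem_powersetCard.1 hS).2
    _ = ((typeGraph k G).undir.card : ℝ) + Real.logb 2 3 *
        (((univ : Finset (Fin n)).powersetCard k).filter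
          fun S => ¬ Conflicted G S ∧ (clausesOn G S).card = 2).card + (2 * k + 1) *
        (((univ : Finset (Fin n)).powersetCard k).filter (Conflicted G)).card := by
      simp only [sum_add_distrib, ← mul_sum, sum_boole, typeGraph]
    _ ≤ _ := by gcongr

lemma card_undir_add_card_missingSets_le :
    (typeGraph k G).undir.card + (missingSets k G).card ≤ n.choose k := by
  rw [typeGraph, missingSets, ← card_union_of_disjoint]
  · calc _ ≤ ((univ : Finset (Fin n)).powersetCard k).card :=
          card_le_card (union_subset (filter_subset _ _) (filter_subset _ _))
      _ = n.choose k := by simp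
  · refine disjoint_filter.2 fun S _ h h' => ?_
    simp [h'] at h

lemma pow_le_mul_choose {r n : ℕ} (hn : 2 * r ≤ n) :
    (n : ℝ) ^ r ≤ 2 ^ r * r.factorial * n.choose r := by
  have h1 := Nat.pow_le_choose (α := ℝ) r n
  rw [div_le_iff₀ (by positivity)] at h1
  have h2 : (n : ℝ) ≤ 2 * ((n + 1 - r : ℕ) : ℝ) := by
    have : n ≤ 2 * (n + 1 - r) := by omega
    exact_mod_cast this
  calc (n : ℝ) ^ r ≤ (2 * ((n + 1 - r : ℕ) : ℝ)) ^ r := by gcongr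
    _ = 2 ^ r * ((n + 1 - r : ℕ) : ℝ) ^ r := mul_pow _ _ _
    _ ≤ 2 ^ r * (n.choose r * r.factorial) := by
        gcongr
    _ = _ := by ring

lemma choose_le_pow_cast (n k : ℕ) : (n.choose k : ℝ) ≤ (n : ℝ) ^ k := by
  exact_mod_cast Nat.choose_le_pow n k

/-- A formula of large weight with few non-minimal subformulae has few missing `k`-sets. -/
lemma card_missingSets_le {k : ℕ} (hk : 2 ≤ k) {θ : ℝ} (hθ : Real.logb 2 3 < θ)
    (hturan : ∀ δ' : ℝ, 0 < δ' → ∃ N : ℕ, ∀ n ≥ N, ∀ H : PDG (Fin n),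
      H.IsValid k → ¬ (TkPDG k).IsSubgraph H →
      (H.undir.card : ℝ) + θ * H.dir.card ≤ (1 + δ') * n.choose k) {ε : ℝ} (hε : 0 < ε) :
    ∃ δ₀ : ℝ, 0 < δ₀ ∧ ∃ n₀ : ℕ, ∀ n ≥ n₀, ∀ G : SatFormula (Fin n), ∀ δ ≤ δ₀,
      IsKFormula k G → FewNonMinimal k n G δ → 1 - δ ≤ formulaWt k n G →
      ((missingSets k G).card : ℝ) ≤ ε * n ^ k := by
  set L := Real.logb 2 3 with hL
  have hL1 : 1 ≤ L := by
    rw [hL, Real.le_logb_iff_rpow_le (by norm_num) (by norm_num)]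
    norm_num
  have hL2 : L ≤ 2 := by
    rw [hL, Real.logb_le_iff_le_rpow (by norm_num) (by norm_num)]
    norm_num
  set η := θ - L with hη
  have hη0 : 0 < η := sub_pos.2 hθ
  have hθ1 : 1 ≤ θ := by linarith
  set κ := ε / (2 + 6 / η) with hκ
  have hκ0 : 0 < κ := by positivity
  obtain ⟨N, hN⟩ := hturan (κ / 2) (by positivity)
  set m := max N (k + 1) with hm
  set c : ℝ := 2 ^ (k + 1) * (k + 1).factorial with hc
  have hc0 : 0 < c := by positivity
  have hmc : (0 : ℝ) < m.choose (k + 1) := by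
    exact_mod_cast Nat.choose_pos (le_max_right _ _)
  set ε₃ := min (κ / (2 * k + 1)) (κ / (2 * θ * m.choose (k + 1) * c)) with hε₃
  have hε₃0 : 0 < ε₃ := by
    have : 0 < θ := by linarith
    exact lt_min (by positivity) (by positivity)
  obtain ⟨δ₁, hδ₁, n₁, hbad⟩ := card_badTuples_le (k := k) hε₃0
  refine ⟨min δ₁ κ, lt_min hδ₁ hκ0, max n₁ (max m (2 * (k + 1))),
    fun n hn G δ hδ hG hfew hwt => ?_⟩
  obtain ⟨hn1, hn2⟩ := max_le_iff.1 hn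
  obtain ⟨hmn, hkn⟩ := max_le_iff.1 hn2
  have hX := hbad n hn1 G δ (hδ.trans (min_le_left _ _)) hfew
  have hδκ : δ ≤ κ := hδ.trans (min_le_right _ _)
  have hn0 : (0 : ℝ) < n := by
    have : 0 < n := by omega
    exact_mod_cast this
  have hT := turan_of_few_copies (θ := θ) (δ' := κ / 2) hθ1 (by positivity)
    (hN m (le_max_left _ _)) (le_max_right _ _) hmn (typeGraph_isValid hG)
    (fun x => mem_badTuples_of_embeds hk hG)
  have hW := formulaWt_mul_le hG (show k ≤ n by omega)
  have hM : ((typeGraph k G).undir.card : ℝ) + (missingSets k G).card ≤ n.choose k := by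
    exact_mod_cast card_undir_add_card_missingSets_le
  have hγ : ((((univ : Finset (Fin n)).powersetCard k).filter (Conflicted G)).card : ℝ) * n ≤
      (badTuples k G).card := by
    exact_mod_cast card_conflicted_mul_le hG
  set u : ℝ := (((typeGraph k G).undir.card : ℕ) : ℝ)
  set d : ℝ := (((typeGraph k G).dir.card : ℕ) : ℝ)
  set γ : ℝ := (((((univ : Finset (Fin n)).powersetCard k).filter (Conflicted G)).card : ℕ) : ℝ)
  set C : ℝ := ((n.choose k : ℕ) : ℝ) with hC
  set X : ℝ := (((badTuples k G).card : ℕ) : ℝ)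
  have hC0 : 0 < C := by
    rw [hC]
    exact_mod_cast Nat.choose_pos (by omega)
  have hCn : C ≤ (n : ℝ) ^ k := choose_le_pow_cast n k
  have hd0 : 0 ≤ d := by positivity
  have hγ' : (2 * k + 1) * γ ≤ κ * n ^ k := by
    have h1 : γ ≤ ε₃ * n ^ k := by
      refine le_of_mul_le_mul_right ?_ hn0
      calc γ * n ≤ ε₃ * n ^ (k + 1) := hγ.trans hX
        _ = _ := by ring
    have h2 : (2 * k + 1) * ε₃ ≤ κ := by
      have := min_le_left (κ / (2 * k + 1)) (κ / (2 * θ * m.choose (k + 1) * c))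
      rw [le_div_iff₀ (by positivity)] at this
      linarith
    calc (2 * k + 1) * γ ≤ (2 * k + 1) * (ε₃ * n ^ k) := by gcongr
      _ = ((2 * k + 1) * ε₃) * n ^ k := by ring
      _ ≤ _ := by gcongr
  have hX' : θ * (X * m.choose (k + 1) / n.choose (k + 1)) ≤ κ / 2 := by
    have hNk : (0 : ℝ) < n.choose (k + 1) := by exact_mod_cast Nat.choose_pos (by omega)
    have h1 : X ≤ ε₃ * (c * n.choose (k + 1)) :=
      hX.trans (mul_le_mul_of_nonneg_left (pow_le_mul_choose hkn) hε₃0.le)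
    have h2 : ε₃ * (2 * θ * m.choose (k + 1) * c) ≤ κ := by
      have := min_le_right (κ / (2 * k + 1)) (κ / (2 * θ * m.choose (k + 1) * c))
      rwa [le_div_iff₀ (by positivity)] at this
    rw [← mul_div_assoc, div_le_iff₀ hNk]
    calc θ * (X * m.choose (k + 1))
        ≤ θ * (ε₃ * (c * n.choose (k + 1)) * m.choose (k + 1)) := by gcongr
      _ = (ε₃ * (2 * θ * m.choose (k + 1) * c)) / 2 * n.choose (k + 1) := by ring
      _ ≤ _ := by gcongr
  have hT' : u + θ * d ≤ (1 + κ) * C := by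
    refine hT.trans (mul_le_mul_of_nonneg_right ?_ hC0.le)
    linarith
  have hW' : (1 - κ) * C ≤ u + L * d + κ * n ^ k := by
    have : (1 - κ) * C ≤ formulaWt k n G * C :=
      mul_le_mul_of_nonneg_right (by linarith) hC0.le
    linarith
  have hdη : d * η ≤ 3 * κ * n ^ k := by
    have : κ * C ≤ κ * n ^ k := by gcongr
    rw [hη]
    linarith
  have hd' : d ≤ 3 * κ * n ^ k / η := (le_div_iff₀ hη0).2 hdη
  have hLd : L * d ≤ 2 * (3 * κ * n ^ k / η) :=
    mul_le_mul hL2 hd' hd0 (by norm_num)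
  have hκC : κ * C ≤ κ * n ^ k := by gcongr
  calc ((missingSets k G).card : ℝ) ≤ C - u := by linarith
    _ ≤ κ * n ^ k + 2 * (3 * κ * n ^ k / η) + κ * n ^ k := by linarith
    _ = κ * (2 + 6 / η) * n ^ k := by ring
    _ = ε * n ^ k := by rw [hκ, div_mul_cancel₀ _ (by positivity)]

end Missing

section Chains

variable {k l n : ℕ} {G : SatFormula (Fin n)}

/-- The tuples some facet of which supports no clause. -/
def missingTuples (k : ℕ) (G : SatFormula (Fin n)) : Finset (Fin (k + 1) → Fin n) :=
  univ.filter fun x => ∃ j, (univ.erase j).image x ∈ missingSets k G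

lemma exists_clause_of_notMem_missingTuples {x : Fin (k + 1) → Fin n}
    (hx : Function.Injective x) (hxm : x ∉ missingTuples k G) (j : Fin (k + 1)) :
    ∃ C ∈ G, clauseVars C = (univ.erase j).image x := by
  by_contra! h
  refine hxm (mem_filter.2 ⟨mem_univ _, j, mem_filter.2 ⟨mem_powersetCard.2 ⟨subset_univ _, ?_⟩,
    eq_empty_of_forall_notMem fun C hC => ?_⟩⟩)
  · rw [card_image_of_injective _ hx]
    simp
  · exact h C (mem_clausesOn.1 hC).1 (mem_clausesOn.1 hC).2

lemma card_missingTuples_le :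
    (missingTuples k G).card ≤ (k + 1) * (k ^ k * ((missingSets k G).card * n)) := by
  have hsub : missingTuples k G ⊆ (univ : Finset (Fin (k + 1))).biUnion fun j =>
      univ.filter fun x : Fin (k + 1) → Fin n => (univ.erase j).image x ∈ missingSets k G := by
    intro x hx
    obtain ⟨j, hj⟩ := (mem_filter.1 hx).2
    exact mem_biUnion.2 ⟨j, mem_univ _, mem_filter.2 ⟨mem_univ _, hj⟩⟩
  refine (card_le_card hsub).trans ?_
  refine (card_biUnion_le_card_mul _ _ (k ^ k * ((missingSets k G).card * n)) fun j _ => ?_).trans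
    (by simp)
  have hcard : (missingSets k G ×ˢ (univ : Finset (Fin n))).card =
      (missingSets k G).card * n := by simp [card_product]
  rw [← hcard]
  refine card_le_mul_card_image_of_maps_to (f := fun x => ((univ.erase j).image x, x j))
    (fun x hx => mem_product.2 ⟨(mem_filter.1 hx).2, mem_univ _⟩) _ ?_
  rintro ⟨S, w⟩ hSw
  have hS : S.card = k := (mem_powersetCard.1 (mem_filter.1 (mem_product.1 hSw).1).1).2
  calc _ ≤ (Fintype.piFinset fun i => if i = j then {w} else S).card := by
        refine card_le_card fun x hx => Fintype.mem_piFinset.2 fun i => ?_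
        obtain ⟨h1, h2⟩ := Prod.ext_iff.1 (mem_filter.1 hx).2
        simp only at h1 h2
        split_ifs with hij
        · simp [hij, h2]
        · rw [← h1]
          exact mem_image_of_mem _ (mem_erase.2 ⟨hij, mem_univ _⟩)
    _ = k ^ k := by
        rw [Fintype.card_piFinset, ← mul_prod_erase _ _ (mem_univ j),
          prod_congr rfl (g := fun _ => k)]
        · simp
        · intro i hi
          simp [(mem_erase.1 hi).1, hS]

/-- The `i`-th window of a chain: position `0` and the positions `i + 1, …, i + l + 1`. -/
def window (i : Fin l) (j : Fin (l + 1 + 1)) : Fin (l + l + 1) :=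
  ⟨if j = 0 then 0 else i + j, by split_ifs <;> omega⟩

lemma window_injective (i : Fin l) : Function.Injective (window i) := by
  intro a b hab
  simp only [window, Fin.mk.injEq] at hab
  rw [Fin.ext_iff]
  split_ifs at hab with h1 h2 h2 <;> simp only [Fin.ext_iff, Fin.val_zero] at h1 h2 <;> omega

/-- The `i`-th link of a chain: position `0` and the positions `i + 1, …, i + l`. -/
def link (l i : ℕ) : Finset (Fin (l + l + 1)) :=
  univ.filter fun t => t.1 = 0 ∨ (i + 1 ≤ t.1 ∧ t.1 ≤ i + l)

lemma image_window_erase_last (i : Fin l) :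
    (univ.erase (Fin.last (l + 1))).image (window i) = link l i := by
  have h1 : (Fin.last (l + 1) : ℕ) = l + 1 := Fin.val_last _
  ext t
  simp only [mem_image, mem_erase, mem_univ, and_true, link, mem_filter, true_and, window,
    Fin.ext_iff, Fin.val_zero]
  constructor
  · rintro ⟨j, hj, h⟩
    split_ifs at h with h0 <;> omega
  · rintro (h | h)
    · exact ⟨0, by simp, by simp [h]⟩
    · have ht : t.1 - i.1 < l + 1 + 1 := by omega
      refine ⟨⟨t.1 - i.1, ht⟩, ?_, ?_⟩
      · rw [Ne, Fin.ext_iff]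
        show ¬ t.1 - i.1 = _
        omega
      · show (if t.1 - i.1 = 0 then 0 else i.1 + (t.1 - i.1)) = t.1
        split_ifs <;> omega

lemma image_window_erase_one (i : Fin l) :
    (univ.erase 1).image (window i) = link l (i + 1) := by
  have h1 : ((1 : Fin (l + 1 + 1)) : ℕ) = 1 := Fin.val_one l
  ext t
  simp only [mem_image, mem_erase, mem_univ, and_true, link, mem_filter, true_and, window,
    Fin.ext_iff, Fin.val_zero]
  constructor
  · rintro ⟨j, hj, h⟩
    split_ifs at h with h0 <;> omega
  · rintro (h | h)
    · exact ⟨0, by simp, by simp [h]⟩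
    · have ht : t.1 - i.1 < l + 1 + 1 := by omega
      refine ⟨⟨t.1 - i.1, ht⟩, ?_, ?_⟩
      · rw [Ne, Fin.ext_iff]
        show ¬ t.1 - i.1 = _
        omega
      · show (if t.1 - i.1 = 0 then 0 else i.1 + (t.1 - i.1)) = t.1
        split_ifs <;> omega

lemma window_mem_of_opposite (hG : IsKFormula (l + 1) G) {z : Fin (l + l + 1) → Fin n}
    (hz : Function.Injective z) (i : Fin l)
    (hmiss : z ∘ window i ∉ missingTuples (l + 1) G) {Q R : SatClause (Fin n)} (hQ : Q ∈ G)
    (hR : R ∈ G) (hQi : clauseVars Q = (link l i).image z)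
    (hRi : clauseVars R = (link l (i + 1)).image z) (hs : (z 0, true) ∈ Q)
    (ht : (z 0, false) ∈ R) : z ∘ window i ∈ badTuples (l + 1) G := by
  have hx := hz.comp (window_injective i)
  obtain ⟨P, hP, hPv⟩ := exists_clause_of_notMem_missingTuples hx hmiss 0
  have hl : 0 < l := i.pos
  have h0 : window i 0 = 0 := by simp [window]
  refine triple_mem_badTuples hG hx (v := 0) (a := Fin.last (l + 1)) (b := 1) ?_ ?_ ?_ hP hQ hR
    hPv ?_ ?_ (s := true) (t := false) (by simp) ?_ ?_
  · simp [Fin.ext_iff]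
  · simp
  · simp [Fin.ext_iff, hl.ne']
  · rw [← image_image, image_window_erase_last, hQi]
  · rw [← image_image, image_window_erase_one, hRi]
  · simpa [h0] using hs
  · simpa [h0] using ht

/-- Opposite clauses at the two ends of a chain force a bad or missing window. -/
lemma exists_window_mem_of_opposite (hl : 0 < l) (hG : IsKFormula (l + 1) G)
    {z : Fin (l + l + 1) → Fin n} (hz : Function.Injective z) {C C' : SatClause (Fin n)}
    (hC : C ∈ G) (hC' : C' ∈ G) (hCz : clauseVars C = (link l 0).image z)
    (hCz' : clauseVars C' = (link l l).image z) (hs : (z 0, true) ∈ C)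
    (ht : (z 0, false) ∈ C') :
    ∃ i : Fin l, z ∘ window i ∈ badTuples (l + 1) G ∪ missingTuples (l + 1) G := by
  by_contra! h
  simp only [mem_union, not_or] at h
  have key : ∀ i < l, ∃ D ∈ G, clauseVars D = (link l i).image z ∧ (z 0, true) ∈ D := by
    intro i
    induction i with
    | zero => exact fun _ => ⟨C, hC, hCz, hs⟩
    | succ i ih =>
      intro hi
      obtain ⟨D, hD, hDz, hDs⟩ := ih (by omega)
      have hil : i < l := by omega
      obtain ⟨R, hR, hRz⟩ := exists_clause_of_notMem_missingTuples
        (hz.comp (window_injective ⟨i, hil⟩)) (h ⟨i, hil⟩).2 1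
      rw [← image_image, image_window_erase_one] at hRz
      have h0 : z 0 ∈ clauseVars R := by
        rw [hRz]
        exact mem_image_of_mem _ (by simp [link])
      obtain ⟨t, ht⟩ := mem_clauseVars.1 h0
      cases t
      · exact absurd (window_mem_of_opposite hG hz ⟨i, hil⟩ (h ⟨i, hil⟩).2 hD hR hDz hRz hDs ht)
          (h ⟨i, hil⟩).1
      · exact ⟨R, hR, hRz, ht⟩
  obtain ⟨D, hD, hDz, hDs⟩ := key (l - 1) (by omega)
  have hll : l - 1 + 1 = l := by omega
  exact (h ⟨l - 1, by omega⟩).1 (window_mem_of_opposite hG hz ⟨l - 1, by omega⟩ (h _).2 hD hC' hDz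
    (by simpa [hll] using hCz') hDs ht)

lemma exists_chain {S S' : Finset (Fin n)} (hS : S.card = l + 1) (hS' : S'.card = l + 1)
    {v : Fin n} (hv : v ∈ S) (hv' : v ∈ S') :
    ∃ z : Fin (l + l + 1) → Fin n, z 0 = v ∧ S = (link l 0).image z ∧ S' = (link l l).image z := by
  have hE : (S.erase v).card = l := by rw [card_erase_of_mem hv, hS]; rfl
  have hE' : (S'.erase v).card = l := by rw [card_erase_of_mem hv', hS']; rfl
  set e : Fin l → Fin n := ⇑((S.erase v).orderEmbOfFin hE) with he
  set e' : Fin l → Fin n := ⇑((S'.erase v).orderEmbOfFin hE') with he'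
  have hr : ∀ y, y ∈ S.erase v ↔ ∃ i, e i = y := fun y => by
    have := (S.erase v).range_orderEmbOfFin hE
    rw [← mem_coe, ← this]
    rfl
  have hr' : ∀ y, y ∈ S'.erase v ↔ ∃ i, e' i = y := fun y => by
    have := (S'.erase v).range_orderEmbOfFin hE'
    rw [← mem_coe, ← this]
    rfl
  refine ⟨Fin.cons v (Fin.append e e'), by simp, ?_, ?_⟩
  · ext y
    rw [← insert_erase hv, mem_insert, hr, mem_image]
    constructor
    · rintro (rfl | ⟨i, rfl⟩)
      · exact ⟨0, by simp [link], by simp⟩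
      · refine ⟨(Fin.castAdd l i).succ, mem_filter.2 ⟨mem_univ _, Or.inr ?_⟩, by simp⟩
        simp only [Fin.val_succ, Fin.val_castAdd]
        omega
    · rintro ⟨t, ht, rfl⟩
      have ht := (mem_filter.1 ht).2
      refine Fin.cases (fun _ => Or.inl (by simp)) (fun t ht => Or.inr ?_) t ht
      simp only [Fin.val_succ] at ht
      refine ⟨⟨t, by omega⟩, ?_⟩
      rw [Fin.cons_succ]
      exact (Fin.append_left e e' ⟨t, by omega⟩).symm
  · ext y
    rw [← insert_erase hv', mem_insert, hr', mem_image]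
    constructor
    · rintro (rfl | ⟨i, rfl⟩)
      · exact ⟨0, by simp [link], by simp⟩
      · refine ⟨(Fin.natAdd l i).succ, mem_filter.2 ⟨mem_univ _, Or.inr ?_⟩,
          by rw [Fin.cons_succ, Fin.append_right]⟩
        simp only [Fin.val_succ, Fin.val_natAdd]
        omega
    · rintro ⟨t, ht, rfl⟩
      have ht := (mem_filter.1 ht).2
      refine Fin.cases (fun _ => Or.inl (by simp)) (fun t ht => Or.inr ?_) t ht
      simp only [Fin.val_succ] at ht
      refine ⟨⟨t - l, by omega⟩, ?_⟩
      have : Fin.natAdd l ⟨t - l, by omega⟩ = t := Fin.ext (by simp only [Fin.val_natAdd]; omega)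
      rw [Fin.cons_succ, ← Fin.append_right e e', this]

/-- The clauses in which `v` has polarity `s`. -/
def clausesWith (G : SatFormula (Fin n)) (v : Fin n) (s : Bool) : SatFormula (Fin n) :=
  G.filter fun C => (v, s) ∈ C

/-- The degenerate chains and those with a bad or missing window. -/
noncomputable def badChains (l : ℕ) (G : SatFormula (Fin n)) : Finset (Fin (l + l + 1) → Fin n) :=
  (univ.filter fun z => ¬ Function.Injective z) ∪ (univ : Finset (Fin l)).biUnion fun i =>
    univ.filter fun z => z ∘ window i ∈ badTuples (l + 1) G ∪ missingTuples (l + 1) G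

lemma card_badChains_le (hl : 0 < l) :
    (badChains l G).card ≤ (l + l + 1) ^ 2 * n ^ (l + l) + l *
      (((badTuples (l + 1) G).card + (missingTuples (l + 1) G).card) * n ^ (l - 1)) := by
  refine (card_union_le _ _).trans (add_le_add ?_ ?_)
  · simpa using card_filter_not_injective_le (ι := Fin (l + l + 1)) (α := Fin n)
  · refine (card_biUnion_le_card_mul _ _ (((badTuples (l + 1) G).card +
      (missingTuples (l + 1) G).card) * n ^ (l - 1)) fun i _ => ?_).trans (by simp)
    refine (card_filter_comp_mem_le (window_injective i) _).trans ?_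
    have : l + l + 1 - (l + 2) = l - 1 := by omega
    simp only [Fintype.card_fin, this]
    gcongr
    exact card_union_le _ _

lemma sum_card_clausesWith_mul_le (hl : 0 < l) (hG : IsKFormula (l + 1) G) :
    ∑ v, (clausesWith G v true).card * (clausesWith G v false).card ≤
      (badChains l G).card * 4 ^ (l + l + 1) := by
  simp_rw [← card_product]
  rw [← card_sigma]
  calc _ ≤ (((badChains l G) ×ˢ (univ : Finset ((Fin (l + l + 1) → Bool) ×
        (Fin (l + l + 1) → Bool)))).image fun y => (⟨y.1 0, clauseAlong y.1 (link l 0) y.2.1,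
          clauseAlong y.1 (link l l) y.2.2⟩ :
          Σ _ : Fin n, SatClause (Fin n) × SatClause (Fin n))).card := by
        refine card_le_card ?_
        rintro ⟨v, C, C'⟩ h
        obtain ⟨-, h⟩ := mem_sigma.1 h
        simp only [mem_product, clausesWith, mem_filter] at h
        obtain ⟨⟨hC, hv⟩, hC', hv'⟩ := h
        obtain ⟨z, rfl, hz, hz'⟩ := exists_chain (hG C hC).2 (hG C' hC').2
          (mem_clauseVars.2 ⟨_, hv⟩) (mem_clauseVars.2 ⟨_, hv'⟩)
        obtain ⟨p, hp⟩ := exists_eq_clauseAlong (hG C hC) hz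
        obtain ⟨q, hq⟩ := exists_eq_clauseAlong (hG C' hC') hz'
        refine mem_image.2 ⟨(z, p, q), mem_product.2 ⟨?_, mem_univ _⟩, by simp [hp, hq]⟩
        by_cases hinj : Function.Injective z
        · obtain ⟨i, hi⟩ := exists_window_mem_of_opposite hl hG hinj hC hC' hz hz' hv hv'
          exact mem_union_right _ (mem_biUnion.2 ⟨i, mem_univ _, mem_filter.2 ⟨mem_univ _, hi⟩⟩)
        · exact mem_union_left _ (mem_filter.2 ⟨mem_univ _, hinj⟩)
    _ ≤ _ := card_image_le
    _ = _ := by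
        simp only [card_product, card_univ, Fintype.card_prod, Fintype.card_fun, Fintype.card_bool,
          Fintype.card_fin]
        rw [← mul_pow]
        norm_num

lemma exists_unate_of_sum_le {ρ : ℝ} (hρ : 0 < ρ) (hn : 0 < n)
    (h : ((∑ v, (clausesWith G v true).card * (clausesWith G v false).card : ℕ) : ℝ) ≤
      ρ ^ 2 / 4 * n ^ (l + l + 1)) :
    ∃ D ⊆ G, (D.card : ℝ) ≤ ρ * n ^ (l + 1) ∧ UnateFormula (G \ D) := by
  have hs : ∀ v, ∃ s, (clausesWith G v s).card ≤
      min (clausesWith G v true).card (clausesWith G v false).card := by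
    intro v
    rcases le_total (clausesWith G v true).card (clausesWith G v false).card with h | h
    · exact ⟨true, le_min le_rfl h⟩
    · exact ⟨false, le_min h le_rfl⟩
  choose s hs using hs
  refine ⟨univ.biUnion fun v => clausesWith G v (s v),
    biUnion_subset.2 fun v _ => filter_subset _ _, ?_, ?_⟩
  · set c : ℝ := ρ / 2 * n ^ l with hc
    have hn' : (0 : ℝ) < n := by exact_mod_cast hn
    have hc0 : 0 < c := by positivity
    refine le_of_mul_le_mul_right ?_ hc0
    have hv : ∀ v, ((clausesWith G v (s v)).card : ℝ) * c ≤
        c ^ 2 + (clausesWith G v true).card * (clausesWith G v false).card := by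
      intro v
      obtain ⟨h1, h2⟩ := le_min_iff.1 (hs v)
      have h1 : ((clausesWith G v (s v)).card : ℝ) ≤ (clausesWith G v true).card := by
        exact_mod_cast h1
      have h2 : ((clausesWith G v (s v)).card : ℝ) ≤ (clausesWith G v false).card := by
        exact_mod_cast h2
      have h3 := mul_le_mul h1 h2 (by positivity) (by positivity)
      nlinarith [sq_nonneg (((clausesWith G v (s v)).card : ℝ) - c), sq_nonneg c]
    calc ((univ.biUnion fun v => clausesWith G v (s v)).card : ℝ) * c
        ≤ (∑ v, ((clausesWith G v (s v)).card : ℝ)) * c := by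
          gcongr
          exact_mod_cast card_biUnion_le
      _ = ∑ v, ((clausesWith G v (s v)).card : ℝ) * c := sum_mul _ _ _
      _ ≤ ∑ v, (c ^ 2 + ((clausesWith G v true).card : ℝ) * (clausesWith G v false).card) :=
          sum_le_sum fun v _ => hv v
      _ = n * c ^ 2 +
          ((∑ v, (clausesWith G v true).card * (clausesWith G v false).card : ℕ) : ℝ) := by
          push_cast
          rw [sum_add_distrib]
          simp
      _ ≤ n * c ^ 2 + ρ ^ 2 / 4 * n ^ (l + l + 1) := by gcongr
      _ = ρ * n ^ (l + 1) * c := by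
          rw [hc]
          ring
  · rintro v ⟨⟨C, hC, hv⟩, C', hC', hv'⟩
    rw [mem_sdiff, mem_biUnion] at hC hC'
    cases hsv : s v
    · exact hC'.2 ⟨v, mem_univ _, mem_filter.2 ⟨hC'.1, hsv ▸ hv'⟩⟩
    · exact hC.2 ⟨v, mem_univ _, mem_filter.2 ⟨hC.1, hsv ▸ hv⟩⟩

end Chains
end NearlyUnate

/-- Fix `k ≥ 2` and `θ > log₂ 3` satisfying the Turán bound `π(T_k,θ) = 1`.
Then for every `ρ > 0` there exist `δ > 0` and `n₀` such that for all `n ≥ n₀`: every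
`k`-SAT formula `G` on `n` variables which contains at most `δ·n^{v(B)}` copies of every
simple non-minimal formula `B` on at most `2(k+1)` variables, and has `wt(G) ≥ 1 − δ`, can
be made unate by deleting at most `ρ·n^k` clauses. -/
theorem large_containers_nearly_unate (k : ℕ) (hk : 2 ≤ k) (θ : ℝ)
    (hθ : Real.logb 2 3 < θ)
    (hturan : ∀ δ' : ℝ, 0 < δ' → ∃ N : ℕ, ∀ n ≥ N, ∀ H : PDG (Fin n),
      H.IsValid k → ¬ (TkPDG k).IsSubgraph H →
      (H.undir.card : ℝ) + θ * H.dir.card ≤ (1 + δ') * n.choose k) :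
    ∀ ρ : ℝ, 0 < ρ → ∃ δ : ℝ, 0 < δ ∧ ∃ n₀ : ℕ, ∀ n ≥ n₀,
      ∀ G : SatFormula (Fin n), IsKFormula k G →
      (∀ B : SatFormula (Fin (2 * (k + 1))), IsKFormula k B → SimpleFormula B →
        ¬ MinimalFormula B → (copyCount B G : ℝ) ≤ δ * n ^ (formulaVars B).card) →
      1 - δ ≤ formulaWt k n G →
      ∃ D ⊆ G, (D.card : ℝ) ≤ ρ * n ^ k ∧ UnateFormula (G \ D) := by
  intro ρ hρ
  obtain ⟨l, rfl⟩ : ∃ l, k = l + 1 := ⟨k - 1, by omega⟩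
  have hl : 0 < l := by omega
  set A : ℝ := 4 ^ (l + l + 1) with hA
  set K : ℝ := (l + 1 + 1) * (l + 1) ^ (l + 1) with hK
  have hl' : (0 : ℝ) < l := by exact_mod_cast hl
  have hA0 : 0 < A := by positivity
  have hK0 : 0 < K := by positivity
  set ε : ℝ := ρ ^ 2 / (8 * A * (l * (1 + K))) with hε
  have hε0 : 0 < ε := by positivity
  obtain ⟨δ₁, hδ₁, n₁, hbad⟩ := NearlyUnate.card_badTuples_le (k := l + 1) hε0
  obtain ⟨δ₂, hδ₂, n₂, hmiss⟩ := NearlyUnate.card_missingSets_le hk hθ hturan hε0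
  obtain ⟨n₃, hn₃⟩ := exists_nat_gt (8 * A * (l + l + 1) ^ 2 / ρ ^ 2)
  refine ⟨min δ₁ δ₂, lt_min hδ₁ hδ₂, max (max n₁ n₂) (max n₃ 1), fun n hn G hG hfew hwt => ?_⟩
  simp only [ge_iff_le, max_le_iff] at hn
  obtain ⟨⟨hn1, hn2⟩, hn3, hn0⟩ := hn
  have hB := hbad n hn1 G _ (min_le_left _ _) hfew
  have hS := hmiss n hn2 G _ (min_le_right _ _) hG hfew hwt
  have hM : ((NearlyUnate.missingTuples (l + 1) G).card : ℝ) ≤ K * ε * n ^ (l + 1 + 1) := by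
    have h : ((NearlyUnate.missingTuples (l + 1) G).card : ℝ) ≤ (l + 1 + 1) * ((l + 1) ^ (l + 1) *
        ((NearlyUnate.missingSets (l + 1) G).card * n)) := by
      exact_mod_cast NearlyUnate.card_missingTuples_le
    calc _ ≤ _ := h
      _ ≤ (l + 1 + 1) * ((l + 1) ^ (l + 1) * (ε * n ^ (l + 1) * n)) := by gcongr
      _ = _ := by rw [hK]; ring
  have hC : ((NearlyUnate.badChains l G).card : ℝ) ≤ (l + l + 1) ^ 2 * n ^ (l + l) + l *
      (((NearlyUnate.badTuples (l + 1) G).card + (NearlyUnate.missingTuples (l + 1) G).card) *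
        n ^ (l - 1)) := by
    exact_mod_cast NearlyUnate.card_badChains_le hl
  have hP : ((∑ v, (NearlyUnate.clausesWith G v true).card *
      (NearlyUnate.clausesWith G v false).card : ℕ) : ℝ) ≤
      (NearlyUnate.badChains l G).card * A := by
    rw [hA]
    exact_mod_cast NearlyUnate.sum_card_clausesWith_mul_le hl hG
  refine NearlyUnate.exists_unate_of_sum_le hρ hn0 (hP.trans ?_)
  have hdeg : 8 * A * (l + l + 1) ^ 2 ≤ ρ ^ 2 * n := by
    have h : 8 * A * (l + l + 1) ^ 2 / ρ ^ 2 ≤ n :=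
      hn₃.le.trans (by exact_mod_cast hn3)
    rwa [div_le_iff₀' (by positivity)] at h
  have hpow : (n : ℝ) ^ (l + 1 + 1) * n ^ (l - 1) = n ^ (l + l + 1) := by
    rw [← pow_add]
    congr 1
    omega
  have hεA : 8 * A * (l * (1 + K)) * ε = ρ ^ 2 := mul_div_cancel₀ _ (by positivity)
  calc ((NearlyUnate.badChains l G).card : ℝ) * A
      ≤ ((l + l + 1) ^ 2 * n ^ (l + l) + l *
        ((ε * n ^ (l + 1 + 1) + K * ε * n ^ (l + 1 + 1)) * n ^ (l - 1))) * A := by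
        gcongr
        exact hC.trans (by gcongr)
    _ = (8 * A * (l + l + 1) ^ 2) * n ^ (l + l) / 8 + (8 * A * (l * (1 + K)) * ε) *
        (n ^ (l + 1 + 1) * n ^ (l - 1)) / 8 := by ring
    _ ≤ (ρ ^ 2 * n) * n ^ (l + l) / 8 + ρ ^ 2 * n ^ (l + l + 1) / 8 := by
        rw [hpow, hεA]
        gcongr
    _ = ρ ^ 2 / 4 * n ^ (l + l + 1) := by ring
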